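/- For each M > 0, the maximizers of E over the relaxed class K̃_M are exactly the maximizers over the patch class K_M: an ω ∈ K̃_M satisfies E(ω') ≤ E(ω) for all ω' ∈ K̃_M if and only if ω ∈ K_M and E(ω'') ≤ E(ω) for all ω'' ∈ K_M. In particular, every maximizer of E over K̃_M has full impulse ‖x₂ω‖₁ = M and is a.e. equal to the indicator function of a measurable subset of ℝ²₊. -/

import Mathlib

open MeasureTheory Real Set NNReal Filter Topology

noncomputable section

/-- The upper half plane `ℝ²₊`. -/
def H : Set (ℝ × ℝ) := {p | 0 < p.2}

/-- The half-plane Green function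
`G(x,y) = (1/(4π)) log(1 + 4 x₂ y₂ / |x-y|²)` (Euclidean distance). -/
def G (x y : ℝ × ℝ) : ℝ :=
  (1 / (4 * π)) * Real.log (1 + 4 * x.2 * y.2 / ((x.1 - y.1) ^ 2 + (x.2 - y.2) ^ 2))

/-- The potential `𝒢[ω](x) = ∫_{ℝ²₊} G(x,y) ω(y) dy`. -/
def Gpot (ω : ℝ × ℝ → ℝ) (x : ℝ × ℝ) : ℝ := ∫ y in H, G x y * ω y

/-- The kinetic energy `E(ω) = (1/2) ∫∫ G(x,y) ω(x) ω(y) dy dx`. -/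
def energy (ω : ℝ × ℝ → ℝ) : ℝ :=
  (1 / 2) * ∫ x in H, ∫ y in H, G x y * ω x * ω y

/-- The `L¹(ℝ²₊)` norm (mass). -/
def norm1 (ω : ℝ × ℝ → ℝ) : ℝ := ∫ x in H, |ω x|

/-- The `L²(ℝ²₊)` norm. -/
def norm2 (ω : ℝ × ℝ → ℝ) : ℝ := (∫ x in H, ω x ^ 2) ^ ((1 : ℝ) / 2)

/-- The impulse `‖x₂ ω‖₁ = ∫_{ℝ²₊} x₂ |ω(x)| dx`. -/
def impulse (ω : ℝ × ℝ → ℝ) : ℝ := ∫ x in H, x.2 * |ω x|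

/-- `ω ∈ (L¹ ∩ L²)(ℝ²₊)`. -/
def MemL1L2 (ω : ℝ × ℝ → ℝ) : Prop :=
  Integrable ω (volume.restrict H) ∧ Integrable (fun x => ω x ^ 2) (volume.restrict H)

/-- Finiteness of the impulse `‖x₂ ω‖₁ < ∞`. -/
def ImpulseFinite (ω : ℝ × ℝ → ℝ) : Prop :=
  Integrable (fun x : ℝ × ℝ => x.2 * |ω x|) (volume.restrict H)

/-- The admissible class `K_M`: patches `ω = 1_A` a.e. on `ℝ²₊` with
impulse `∫_A x₂ = M` and mass `|A| ≤ 1`. -/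
def memK (M : ℝ) (ω : ℝ × ℝ → ℝ) : Prop :=
  Integrable ω (volume.restrict H) ∧
  ∃ A : Set (ℝ × ℝ), A ⊆ H ∧ MeasurableSet A ∧
    (∀ᵐ x ∂volume.restrict H, ω x = A.indicator (fun _ => (1 : ℝ)) x) ∧
    (∫ x in A, x.2) = M ∧ volume A ≤ 1

/-- The admissible class `K_{M,∞}`: patches `ω = 1_A` a.e. on `ℝ²₊` with
impulse `∫_A x₂ = M`, without any mass bound. -/
def memKinf (M : ℝ) (ω : ℝ × ℝ → ℝ) : Prop :=
  Integrable ω (volume.restrict H) ∧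
  ∃ A : Set (ℝ × ℝ), A ⊆ H ∧ MeasurableSet A ∧
    (∀ᵐ x ∂volume.restrict H, ω x = A.indicator (fun _ => (1 : ℝ)) x) ∧
    (∫ x in A, x.2) = M

/-- The relaxed admissible class `K̃_M`: measurable `0 ≤ ω ≤ 1` with
mass `≤ 1` and impulse `≤ M`. -/
def memKt (M : ℝ) (ω : ℝ × ℝ → ℝ) : Prop :=
  Integrable ω (volume.restrict H) ∧
  (∀ᵐ x ∂volume.restrict H, 0 ≤ ω x ∧ ω x ≤ 1) ∧
  norm1 ω ≤ 1 ∧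
  Integrable (fun x : ℝ × ℝ => x.2 * |ω x|) (volume.restrict H) ∧
  impulse ω ≤ M

/-- The set of maximizers `S_M` of the energy over `K_M`. -/
def memS (M : ℝ) (ω : ℝ × ℝ → ℝ) : Prop :=
  memK M ω ∧ ∀ ω' : ℝ × ℝ → ℝ, memK M ω' → energy ω' ≤ energy ω

/-- The maximal energy `I_M` over `K_M`. -/
def Isup (M : ℝ) : ℝ := sSup (energy '' {ω | memK M ω})

/-- The maximal energy `I_{1,∞}` over `K_{1,∞}`. -/
def IsupInf : ℝ := sSup (energy '' {ω | memKinf 1 ω})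

/-- The Steiner symmetry condition for a set `Ω ⊆ ℝ²₊`. -/
def SteinerSet (Ω : Set (ℝ × ℝ)) : Prop :=
  (∀ x₁ x₂ : ℝ, 0 < x₂ → (((x₁, x₂) : ℝ × ℝ) ∈ Ω ↔ ((-x₁, x₂) : ℝ × ℝ) ∈ Ω)) ∧
  (∀ x₂ : ℝ, 0 < x₂ → ∀ a b : ℝ, 0 ≤ a → a ≤ b →
    ((b, x₂) : ℝ × ℝ) ∈ Ω → ((a, x₂) : ℝ × ℝ) ∈ Ω)

/-- The Steiner symmetry condition for a nonnegative function on `ℝ²₊`. -/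
def SteinerFn (f : ℝ × ℝ → ℝ) : Prop :=
  (∀ x₁ x₂ : ℝ, 0 < x₂ → f (x₁, x₂) = f (-x₁, x₂)) ∧
  (∀ x₂ : ℝ, 0 < x₂ → ∀ a b : ℝ, 0 ≤ a → a ≤ b → f (b, x₂) ≤ f (a, x₂))

/-- The Euclidean distance between two points of the plane. -/
def planeDist (x y : ℝ × ℝ) : ℝ := √((x.1 - y.1) ^ 2 + (x.2 - y.2) ^ 2)

lemma measurableSet_H : MeasurableSet H := measurableSet_lt measurable_const measurable_snd

lemma ae_mem_H : ∀ᵐ x ∂volume.restrict H, x ∈ H := ae_restrict_mem measurableSet_H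

lemma measurable_planeDist : Measurable fun z : (ℝ × ℝ) × (ℝ × ℝ) => planeDist z.1 z.2 := by
  unfold planeDist
  fun_prop

lemma measurable_G : Measurable fun z : (ℝ × ℝ) × (ℝ × ℝ) => G z.1 z.2 := by
  unfold G
  fun_prop

lemma G_comm (x y : ℝ × ℝ) : G x y = G y x := by
  unfold G
  congr 2
  ring

lemma planeDist_nonneg (x y : ℝ × ℝ) : 0 ≤ planeDist x y := Real.sqrt_nonneg _

lemma planeDist_sq (x y : ℝ × ℝ) : planeDist x y ^ 2 = (x.1 - y.1) ^ 2 + (x.2 - y.2) ^ 2 :=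
  Real.sq_sqrt (by positivity)

lemma planeDist_pos {x y : ℝ × ℝ} (h : x ≠ y) : 0 < planeDist x y := by
  apply Real.sqrt_pos.2
  by_contra! hle
  have h₁ : x.1 - y.1 = 0 := by nlinarith [sq_nonneg (x.1 - y.1), sq_nonneg (x.2 - y.2)]
  have h₂ : x.2 - y.2 = 0 := by nlinarith [sq_nonneg (x.1 - y.1), sq_nonneg (x.2 - y.2)]
  exact h (Prod.ext (by linarith) (by linarith))

lemma snd_le_add_planeDist (x y : ℝ × ℝ) : y.2 ≤ x.2 + planeDist x y := by
  have : |x.2 - y.2| ≤ planeDist x y := Real.abs_le_sqrt (by nlinarith [sq_nonneg (x.1 - y.1)])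
  linarith [(abs_le.1 this).1]

lemma G_nonneg {x y : ℝ × ℝ} (hx : x ∈ H) (hy : y ∈ H) : 0 ≤ G x y := by
  have hx : 0 < x.2 := hx
  have hy : 0 < y.2 := hy
  unfold G
  have : 0 ≤ 4 * x.2 * y.2 / ((x.1 - y.1) ^ 2 + (x.2 - y.2) ^ 2) := by positivity
  exact mul_nonneg (by positivity) (Real.log_nonneg (by linarith))

lemma G_le {x y : ℝ × ℝ} (hx : x ∈ H) (hy : y ∈ H) : G x y ≤ x.2 / planeDist x y := by
  have hx : 0 < x.2 := hx
  have hy : 0 < y.2 := hy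
  rcases eq_or_ne x y with rfl | hxy
  · simp [G, planeDist]
  have hd := planeDist_pos hxy
  have hle := snd_le_add_planeDist x y
  unfold G
  rw [← planeDist_sq]
  set r := planeDist x y
  have h₁ : 1 + 4 * x.2 * y.2 / r ^ 2 ≤ (1 + 2 * (x.2 / r)) ^ 2 := by
    rw [← sub_nonneg]
    have : (1 + 2 * (x.2 / r)) ^ 2 - (1 + 4 * x.2 * y.2 / r ^ 2)
        = 4 * x.2 * (x.2 + r - y.2) / r ^ 2 := by
      field_simp
      ring
    rw [this]
    have : 0 ≤ x.2 + r - y.2 := by linarith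
    positivity
  have hq : 0 < x.2 / r := by positivity
  have h₂ : Real.log (1 + 4 * x.2 * y.2 / r ^ 2) ≤ 4 * (x.2 / r) := by
    calc _ ≤ Real.log ((1 + 2 * (x.2 / r)) ^ 2) := Real.log_le_log (by positivity) h₁
      _ = 2 * Real.log (1 + 2 * (x.2 / r)) := by rw [Real.log_pow]; norm_num
      _ ≤ 2 * (2 * (x.2 / r)) := by
        gcongr
        have := Real.log_le_sub_one_of_pos (show 0 < 1 + 2 * (x.2 / r) by positivity)
        linarith
      _ = _ := by ring
  calc _ ≤ 1 / (4 * π) * (4 * (x.2 / r)) := by gcongr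
    _ = (x.2 / r) / π := by field_simp
    _ ≤ x.2 / r := div_le_self hq.le (by linarith [Real.pi_gt_three])

lemma abs_log_sub_log_le {r s d : ℝ} (hr : 0 < r) (hs : 0 < s) (h : |r - s| ≤ d) :
    |Real.log r - Real.log s| ≤ d * (1 / r + 1 / s) := by
  have hd : 0 ≤ d := (abs_nonneg _).trans h
  have key : ∀ {a b : ℝ}, 0 < a → 0 < b → a - b ≤ d → Real.log a - Real.log b ≤ d * (1 / b) := by
    intro a b ha hb hab
    rw [← Real.log_div ha.ne' hb.ne']
    calc _ ≤ a / b - 1 := Real.log_le_sub_one_of_pos (by positivity)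
      _ = (a - b) * (1 / b) := by field_simp
      _ ≤ _ := by gcongr
  have h₁ := key hr hs (abs_le.1 h).2
  have h₂ := key hs hr (by linarith [(abs_le.1 h).1])
  have h₃ : 0 ≤ d * (1 / r) := by positivity
  have h₄ : 0 ≤ d * (1 / s) := by positivity
  rw [abs_le]
  constructor <;> linarith

lemma abs_sqrt_sub_sqrt_le (a b c : ℝ) : |√(a ^ 2 + c ^ 2) - √(b ^ 2 + c ^ 2)| ≤ |a - b| := by
  have key : ∀ a b : ℝ, √(a ^ 2 + c ^ 2) ≤ √(b ^ 2 + c ^ 2) + |a - b| := by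
    intro a b
    apply Real.sqrt_le_left (by positivity) |>.2
    have h₁ : |b| ≤ √(b ^ 2 + c ^ 2) := Real.abs_le_sqrt (by nlinarith [sq_nonneg c])
    have h₂ := Real.sq_sqrt (show 0 ≤ b ^ 2 + c ^ 2 by positivity)
    have h₃ : b * (a - b) ≤ √(b ^ 2 + c ^ 2) * |a - b| :=
      calc b * (a - b) ≤ |b * (a - b)| := le_abs_self _
        _ = |b| * |a - b| := abs_mul _ _
        _ ≤ _ := by gcongr
    nlinarith [sq_abs (a - b)]
  rw [abs_le]
  constructor
  · have := key b a
    rw [abs_sub_comm] at this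
    linarith
  · linarith [key a b]

lemma G_eq_log_sub_log {x y : ℝ × ℝ} (hx : x ∈ H) (hy : y ∈ H) (hxy : x ≠ y) :
    G x y = (1 / (2 * π)) * (Real.log (planeDist x (y.1, -y.2)) - Real.log (planeDist x y)) := by
  have hx : 0 < x.2 := hx
  have hy : 0 < y.2 := hy
  have hd := planeDist_pos hxy
  have hd' : 0 < planeDist x (y.1, -y.2) := by
    apply planeDist_pos
    intro h
    rw [h] at hx
    simp only at hx
    linarith
  have h : 1 + 4 * x.2 * y.2 / planeDist x y ^ 2
      = planeDist x (y.1, -y.2) ^ 2 / planeDist x y ^ 2 := by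
    rw [eq_div_iff (by positivity), add_mul, div_mul_cancel₀ _ (by positivity), planeDist_sq,
      planeDist_sq]
    ring
  unfold G
  rw [← planeDist_sq, h, Real.log_div (by positivity) (by positivity), Real.log_pow, Real.log_pow]
  field_simp
  push_cast
  ring

lemma abs_G_sub_G_le {a b c : ℝ} {y : ℝ × ℝ} (hc : 0 < c) (hy : y ∈ H) (ha : (a, c) ≠ y)
    (hb : (b, c) ≠ y) :
    |G (a, c) y - G (b, c) y|
      ≤ |a - b| * (1 / planeDist (a, c) y + 1 / planeDist (b, c) y) := by
  have hy' : 0 < y.2 := hy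
  rw [G_eq_log_sub_log hc hy ha, G_eq_log_sub_log hc hy hb]
  have hr := planeDist_pos ha
  have hs := planeDist_pos hb
  have hmono : ∀ t : ℝ, planeDist (t, c) y ≤ planeDist (t, c) (y.1, -y.2) := by
    intro t
    apply Real.sqrt_le_sqrt
    simp only
    nlinarith
  have hlip : ∀ z : ℝ × ℝ, |planeDist (a, c) z - planeDist (b, c) z| ≤ |a - b| := by
    intro z
    have := abs_sqrt_sub_sqrt_le (a - z.1) (b - z.1) (c - z.2)
    simpa [planeDist] using this
  have h₁ := abs_log_sub_log_le hr hs (hlip y)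
  have h₂ := abs_log_sub_log_le (hr.trans_le (hmono a)) (hs.trans_le (hmono b)) (hlip _)
  have h₃ : |a - b| * (1 / planeDist (a, c) (y.1, -y.2) + 1 / planeDist (b, c) (y.1, -y.2))
      ≤ |a - b| * (1 / planeDist (a, c) y + 1 / planeDist (b, c) y) := by
    gcongr
    · exact hmono a
    · exact hmono b
  set R := |a - b| * (1 / planeDist (a, c) y + 1 / planeDist (b, c) y)
  have hR : 0 ≤ R := by positivity
  have hpi : 1 / (2 * π) ≤ 1 / 2 := by
    apply one_div_le_one_div_of_le (by norm_num)
    linarith [Real.pi_gt_three]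
  rw [← mul_sub, abs_mul, abs_of_pos (by positivity : 0 < 1 / (2 * π))]
  have h₄ : |Real.log (planeDist (a, c) (y.1, -y.2)) - Real.log (planeDist (a, c) y)
      - (Real.log (planeDist (b, c) (y.1, -y.2)) - Real.log (planeDist (b, c) y))| ≤ 2 * R := by
    rw [abs_le] at *
    constructor <;> linarith
  calc _ ≤ 1 / 2 * (2 * R) := by gcongr
    _ = R := by ring

lemma norm_le_planeDist (x y : ℝ × ℝ) : ‖x - y‖ ≤ planeDist x y := by
  rw [Prod.norm_def]
  apply max_le
  · exact Real.abs_le_sqrt (by simp only [Prod.fst_sub]; nlinarith [sq_nonneg (x.2 - y.2)])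
  · exact Real.abs_le_sqrt (by simp only [Prod.snd_sub]; nlinarith [sq_nonneg (x.1 - y.1)])

lemma one_div_planeDist_zero_le (z : ℝ × ℝ) : 1 / planeDist z 0 ≤ 1 / ‖z‖ := by
  rcases eq_or_ne z 0 with rfl | hz
  · simp [planeDist]
  · have := norm_le_planeDist z 0
    rw [sub_zero] at this
    exact one_div_le_one_div_of_le (norm_pos_iff.2 hz) this

lemma lintegral_ball_one_div_planeDist_lt_top :
    ∫⁻ z in Metric.ball (0 : ℝ × ℝ) 1, ENNReal.ofReal (1 / planeDist z 0) < ⊤ := by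
  have hmeas : Measurable fun z : ℝ × ℝ => 1 / planeDist z 0 := by
    unfold planeDist
    fun_prop
  have h : IntegrableOn (fun z : ℝ × ℝ => 1 / planeDist z 0) (Metric.ball 0 1) := by
    refine integrableOn_ball_of_norm_le_rpow (C := 1) (α := 1) (by simp) (by simp) ?_
      hmeas.aestronglyMeasurable
    refine ae_of_all _ fun z => ?_
    rw [Real.norm_of_nonneg (one_div_nonneg.2 (planeDist_nonneg _ _)), Real.rpow_neg_one, one_mul,
      ← one_div]
    exact one_div_planeDist_zero_le z
  exact h.lintegral_lt_top

/-- The integral of the kernel `1 / |x - y|` over the unit ball. -/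
def ballMass : ENNReal :=
  ∫⁻ z in Metric.ball (0 : ℝ × ℝ) 1, ENNReal.ofReal (1 / planeDist z 0)

lemma lintegral_mul_one_div_planeDist_le {g : ℝ × ℝ → ENNReal} {C : ENNReal}
    (hC : ∀ᵐ y ∂volume.restrict H, g y ≤ C) (x : ℝ × ℝ) :
    ∫⁻ y in H, g y * ENNReal.ofReal (1 / planeDist x y) ≤ (∫⁻ y in H, g y) + C * ballMass := by
  have hk : Measurable fun z : ℝ × ℝ => ENNReal.ofReal (1 / planeDist z 0) := by
    unfold planeDist
    fun_prop
  set k : ℝ × ℝ → ENNReal :=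
    (Metric.ball 0 1).indicator fun z => ENNReal.ofReal (1 / planeDist z 0) with hkdef
  have hkm : Measurable k := hk.indicator Metric.isOpen_ball.measurableSet
  have hkx : Measurable fun y => k (x - y) := hkm.comp (measurable_const.sub measurable_id)
  calc _ ≤ ∫⁻ y in H, (g y + C * k (x - y)) := by
        apply lintegral_mono_ae
        filter_upwards [hC] with y hy
        have hxy : planeDist x y = planeDist (x - y) 0 := by simp [planeDist]
        by_cases hb : x - y ∈ Metric.ball (0 : ℝ × ℝ) 1
        · rw [hkdef, indicator_of_mem hb, hxy]
          exact le_add_left (mul_le_mul_left hy _)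
        · apply le_add_right
          have h1 : 1 ≤ ‖x - y‖ := by simpa using hb
          have : 1 / planeDist x y ≤ 1 := by
            have := h1.trans (norm_le_planeDist x y)
            rw [div_le_one (by linarith)]
            exact this
          calc _ ≤ g y * 1 := by gcongr; exact ENNReal.ofReal_le_one.2 this
            _ = _ := mul_one _
    _ = (∫⁻ y in H, g y) + ∫⁻ y in H, C * k (x - y) := lintegral_add_right _ (hkx.const_mul C)
    _ ≤ (∫⁻ y in H, g y) + ∫⁻ y, C * k (x - y) := by
        gcongr
        exact Measure.restrict_le_self
    _ = (∫⁻ y in H, g y) + C * ballMass := by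
        rw [lintegral_const_mul _ hkx, lintegral_sub_left_eq_self k x,
          lintegral_indicator Metric.isOpen_ball.measurableSet]
        rfl

/-- Bounded integrable functions on the half plane with finite impulse. -/
structure Adm (f : ℝ × ℝ → ℝ) : Prop where
  integrable : Integrable f (volume.restrict H)
  bounded : ∃ C : ℝ, ∀ᵐ x ∂volume.restrict H, |f x| ≤ C
  impulse : Integrable (fun x : ℝ × ℝ => x.2 * f x) (volume.restrict H)

lemma Adm.add {f g : ℝ × ℝ → ℝ} (hf : Adm f) (hg : Adm g) : Adm fun x => f x + g x := by
  obtain ⟨C, hC⟩ := hf.bounded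
  obtain ⟨D, hD⟩ := hg.bounded
  refine ⟨hf.integrable.add hg.integrable, ⟨C + D, ?_⟩, ?_⟩
  · filter_upwards [hC, hD] with x h₁ h₂
    exact (abs_add_le _ _).trans (add_le_add h₁ h₂)
  · exact (hf.impulse.add hg.impulse).congr (ae_of_all _ fun x => (mul_add _ _ _).symm)

lemma Adm.const_mul {f : ℝ × ℝ → ℝ} (c : ℝ) (hf : Adm f) : Adm fun x => c * f x := by
  obtain ⟨C, hC⟩ := hf.bounded
  refine ⟨hf.integrable.const_mul c, ⟨|c| * C, ?_⟩, ?_⟩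
  · filter_upwards [hC] with x hx
    rw [abs_mul]
    gcongr
  · exact (hf.impulse.const_mul c).congr (ae_of_all _ fun x => by ring)

lemma Adm.sub {f g : ℝ × ℝ → ℝ} (hf : Adm f) (hg : Adm g) : Adm fun x => f x - g x := by
  simpa [sub_eq_add_neg] using hf.add (hg.const_mul (-1))

lemma memKt.adm {M : ℝ} {ω : ℝ × ℝ → ℝ} (h : memKt M ω) : Adm ω := by
  obtain ⟨hωi, hbd, -, himp, -⟩ := h
  refine ⟨hωi, ⟨1, ?_⟩, himp.congr ?_⟩
  · filter_upwards [hbd] with x hx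
    rw [abs_of_nonneg hx.1]
    exact hx.2
  · filter_upwards [hbd] with x hx
    rw [abs_of_nonneg hx.1]

lemma Adm.exists_lintegral_le {g : ℝ × ℝ → ℝ} (hg : Adm g) :
    ∃ C : ℝ, 0 ≤ C ∧ ∀ x : ℝ × ℝ,
      ∫⁻ y in H, ‖g y‖ₑ * ENNReal.ofReal (1 / planeDist x y) ≤ ENNReal.ofReal C := by
  obtain ⟨D, hD⟩ := hg.bounded
  have hD' : ∀ᵐ y ∂volume.restrict H, ‖g y‖ₑ ≤ ENNReal.ofReal D := by
    filter_upwards [hD] with y hy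
    rw [← ofReal_norm]
    exact ENNReal.ofReal_le_ofReal hy
  have hfin : (∫⁻ y in H, ‖g y‖ₑ) + ENNReal.ofReal D * ballMass ≠ ⊤ :=
    ENNReal.add_ne_top.2 ⟨hg.integrable.2.ne,
      ENNReal.mul_ne_top ENNReal.ofReal_ne_top lintegral_ball_one_div_planeDist_lt_top.ne⟩
  refine ⟨((∫⁻ y in H, ‖g y‖ₑ) + ENNReal.ofReal D * ballMass).toReal, ENNReal.toReal_nonneg,
    fun x => ?_⟩
  rw [ENNReal.ofReal_toReal hfin]
  exact lintegral_mul_one_div_planeDist_le hD' x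

lemma Adm.exists_lintegral_G_le {g : ℝ × ℝ → ℝ} (hg : Adm g) :
    ∃ C : ℝ, 0 ≤ C ∧ ∀ x ∈ H, ∫⁻ y in H, ‖G x y * g y‖ₑ ≤ ENNReal.ofReal (C * x.2) := by
  obtain ⟨C, hC, h⟩ := hg.exists_lintegral_le
  refine ⟨C, hC, fun x hx => ?_⟩
  have hx' : 0 < x.2 := hx
  calc ∫⁻ y in H, ‖G x y * g y‖ₑ
      ≤ ∫⁻ y in H, ENNReal.ofReal x.2 * (‖g y‖ₑ * ENNReal.ofReal (1 / planeDist x y)) := by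
        apply lintegral_mono_ae
        filter_upwards [ae_mem_H] with y hy
        rw [enorm_mul, mul_comm, mul_left_comm, ← ENNReal.ofReal_mul hx'.le,
          Real.enorm_of_nonneg (G_nonneg hx hy)]
        gcongr
        simpa [div_eq_mul_inv] using G_le hx hy
    _ = ENNReal.ofReal x.2 * ∫⁻ y in H, ‖g y‖ₑ * ENNReal.ofReal (1 / planeDist x y) :=
        lintegral_const_mul' _ _ ENNReal.ofReal_ne_top
    _ ≤ ENNReal.ofReal x.2 * ENNReal.ofReal C := by
        gcongr
        exact h x
    _ = _ := by rw [← ENNReal.ofReal_mul hx'.le, mul_comm]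

lemma measurable_G_right (x : ℝ × ℝ) : Measurable fun y => G x y :=
  measurable_G.comp measurable_prodMk_left

lemma Adm.integrable_G_mul {g : ℝ × ℝ → ℝ} (hg : Adm g) {x : ℝ × ℝ} (hx : x ∈ H) :
    Integrable (fun y => G x y * g y) (volume.restrict H) := by
  obtain ⟨C, -, h⟩ := hg.exists_lintegral_G_le
  exact ⟨(measurable_G_right x).aestronglyMeasurable.mul hg.integrable.1,
    (h x hx).trans_lt ENNReal.ofReal_lt_top⟩

lemma Adm.integrable_interaction {f g : ℝ × ℝ → ℝ} (hf : Adm f) (hg : Adm g) :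
    Integrable (fun z : (ℝ × ℝ) × (ℝ × ℝ) => G z.1 z.2 * f z.1 * g z.2)
      ((volume.restrict H).prod (volume.restrict H)) := by
  have hm : AEStronglyMeasurable
      (fun z : (ℝ × ℝ) × (ℝ × ℝ) => G z.1 z.2 * f z.1 * g z.2)
      ((volume.restrict H).prod (volume.restrict H)) :=
    (measurable_G.aestronglyMeasurable.mul hf.integrable.1.comp_fst).mul hg.integrable.1.comp_snd
  refine ⟨hm, ?_⟩
  obtain ⟨C, hC, h⟩ := hg.exists_lintegral_G_le
  unfold HasFiniteIntegral
  rw [lintegral_prod _ hm.enorm]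
  calc _ ≤ ∫⁻ x in H, ENNReal.ofReal C * ‖x.2 * f x‖ₑ := by
        apply lintegral_mono_ae
        filter_upwards [ae_mem_H] with x hx
        have hx' : 0 < x.2 := hx
        calc _ = ∫⁻ y in H, ‖f x‖ₑ * ‖G x y * g y‖ₑ := by
              congr with y
              rw [← enorm_mul]
              congr 1
              ring
          _ = ‖f x‖ₑ * ∫⁻ y in H, ‖G x y * g y‖ₑ := lintegral_const_mul' _ _ (by simp)
          _ ≤ ‖f x‖ₑ * ENNReal.ofReal (C * x.2) := by gcongr; exact h x hx
          _ = _ := by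
            rw [ENNReal.ofReal_mul hC, enorm_mul, Real.enorm_of_nonneg hx'.le]
            ring
    _ = ENNReal.ofReal C * ∫⁻ x in H, ‖x.2 * f x‖ₑ :=
        lintegral_const_mul' _ _ ENNReal.ofReal_ne_top
    _ < ⊤ := ENNReal.mul_lt_top ENNReal.ofReal_lt_top hf.impulse.2

/-- The bilinear form associated with the kinetic energy. -/
def interaction (f g : ℝ × ℝ → ℝ) : ℝ := ∫ x in H, ∫ y in H, G x y * f x * g y

lemma energy_eq_interaction (f : ℝ × ℝ → ℝ) : energy f = 1 / 2 * interaction f f := rfl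

lemma interaction_congr {f f' g g' : ℝ × ℝ → ℝ} (hf : f =ᵐ[volume.restrict H] f')
    (hg : g =ᵐ[volume.restrict H] g') : interaction f g = interaction f' g' := by
  apply integral_congr_ae
  filter_upwards [hf] with x hx
  apply integral_congr_ae
  filter_upwards [hg] with y hy
  rw [hx, hy]

lemma energy_congr {f g : ℝ × ℝ → ℝ} (h : f =ᵐ[volume.restrict H] g) : energy f = energy g := by
  rw [energy_eq_interaction, energy_eq_interaction, interaction_congr h h]

lemma Adm.interaction_eq_integral_prod {f g : ℝ × ℝ → ℝ} (hf : Adm f) (hg : Adm g) :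
    interaction f g = ∫ z, G z.1 z.2 * f z.1 * g z.2
      ∂((volume.restrict H).prod (volume.restrict H)) :=
  (integral_prod _ (hf.integrable_interaction hg)).symm

lemma Adm.interaction_comm {f g : ℝ × ℝ → ℝ} (hf : Adm f) (hg : Adm g) :
    interaction f g = interaction g f := by
  rw [hg.interaction_eq_integral_prod hf, integral_prod_symm _ (hg.integrable_interaction hf)]
  simp only [interaction]
  congr with x
  congr with y
  rw [G_comm x y]
  ring

lemma Adm.interaction_add_left {f f' g : ℝ × ℝ → ℝ} (hf : Adm f) (hf' : Adm f') (hg : Adm g) :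
    interaction (fun x => f x + f' x) g = interaction f g + interaction f' g := by
  rw [(hf.add hf').interaction_eq_integral_prod hg, hf.interaction_eq_integral_prod hg,
    hf'.interaction_eq_integral_prod hg,
    ← integral_add (hf.integrable_interaction hg) (hf'.integrable_interaction hg)]
  congr with z
  ring

lemma interaction_const_mul_left (c : ℝ) (f g : ℝ × ℝ → ℝ) :
    interaction (fun x => c * f x) g = c * interaction f g := by
  unfold interaction
  simp_rw [← integral_const_mul]
  congr with x
  congr with y
  ring

lemma Adm.energy_add {f g : ℝ × ℝ → ℝ} (hf : Adm f) (hg : Adm g) :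
    energy (fun x => f x + g x) = energy f + interaction f g + energy g := by
  simp only [energy_eq_interaction]
  rw [hf.interaction_add_left hg (hf.add hg), hf.interaction_comm (hf.add hg),
    hg.interaction_comm (hf.add hg), hf.interaction_add_left hg hf, hf.interaction_add_left hg hg,
    hg.interaction_comm hf]
  ring

lemma interaction_eq_integral_Gpot (f g : ℝ × ℝ → ℝ) :
    interaction f g = ∫ x in H, Gpot g x * f x := by
  unfold interaction Gpot
  congr with x
  rw [← integral_mul_const]
  congr with y
  ring

lemma tendsto_log_ratio (a b v : ℝ) {l : Filter ℝ} (hl : Tendsto (fun u : ℝ => u⁻¹) l (𝓝 0))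
    (hne : ∀ᶠ u in l, u ≠ 0) (ha : 0 < a) (hb : 0 < b) :
    Tendsto (fun u => Real.log (a ^ 2 + u ^ 2) - Real.log (b ^ 2 + (u - v) ^ 2)) l (𝓝 0) := by
  have hc : ContinuousAt (fun w : ℝ =>
      Real.log ((a ^ 2 * w ^ 2 + 1) / (b ^ 2 * w ^ 2 + (1 - v * w) ^ 2))) 0 := by
    apply ContinuousAt.log
    · apply ContinuousAt.div (by fun_prop) (by fun_prop)
      norm_num
    · norm_num
  have h := hc.tendsto.comp hl
  simp only [ne_eq, OfNat.ofNat_ne_zero, not_false_eq_true, zero_pow, mul_zero, zero_add, sub_zero,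
    one_pow, div_one, Real.log_one] at h
  refine h.congr' ?_
  filter_upwards [hne] with u hu
  simp only [Function.comp_apply]
  rw [← Real.log_div (by positivity) (by positivity)]
  congr 1
  field_simp

lemma integrable_poisson_mul {a b : ℝ} (ha : 0 < a) (hb : 0 < b) (v : ℝ) :
    Integrable fun u : ℝ => a / (a ^ 2 + u ^ 2) * (b / (b ^ 2 + (u - v) ^ 2)) := by
  have h₁ : Integrable fun u : ℝ => a / (a ^ 2 + u ^ 2) := by
    refine ((integrable_inv_one_add_sq.comp_div ha.ne').const_mul a⁻¹).congr
      (ae_of_all _ fun u => ?_)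
    simp only
    field_simp
  refine h₁.mul_bdd (c := b⁻¹) ?_ (ae_of_all _ fun u => ?_)
  · exact Measurable.aestronglyMeasurable (by fun_prop)
  · rw [Real.norm_of_nonneg (by positivity), div_le_iff₀ (by positivity), inv_mul_eq_div,
      le_div_iff₀ hb]
    nlinarith [sq_nonneg (u - v)]

lemma integral_poisson_mul {a b v : ℝ} (ha : 0 < a) (hb : 0 < b) (h : a ≠ b ∨ v ≠ 0) :
    ∫ u : ℝ, a / (a ^ 2 + u ^ 2) * (b / (b ^ 2 + (u - v) ^ 2))
      = π * (a + b) / ((a + b) ^ 2 + v ^ 2) := by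
  have hs : 0 < (a - b) ^ 2 + v ^ 2 := by
    rcases h with h | h
    · have := sub_ne_zero.2 h
      positivity
    · positivity
  have hp : 0 < (a + b) ^ 2 + v ^ 2 := by positivity
  obtain ⟨D, hD⟩ : ∃ D, D = ((a + b) ^ 2 + v ^ 2) * ((a - b) ^ 2 + v ^ 2) := ⟨_, rfl⟩
  have hD0 : D ≠ 0 := by rw [hD]; positivity
  set A := 2 * a * b * v / D with hA
  set B := a * b * (b ^ 2 + v ^ 2 - a ^ 2) / D with hB
  set C := a * b * (v ^ 2 + a ^ 2 - b ^ 2) / D with hC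
  set F : ℝ → ℝ := fun u =>
    A / 2 * (Real.log (a ^ 2 + u ^ 2) - Real.log (b ^ 2 + (u - v) ^ 2))
      + (B / a * Real.arctan (u / a) + C / b * Real.arctan ((u - v) / b)) with hF
  have hderiv : ∀ u, HasDerivAt F (a / (a ^ 2 + u ^ 2) * (b / (b ^ 2 + (u - v) ^ 2))) u := by
    intro u
    have hpa : a ^ 2 + u ^ 2 ≠ 0 := by positivity
    have hpb : b ^ 2 + (u - v) ^ 2 ≠ 0 := by positivity
    have e₁ : HasDerivAt (fun u : ℝ => Real.log (a ^ 2 + u ^ 2)) (2 * u / (a ^ 2 + u ^ 2)) u := by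
      have := (((hasDerivAt_id u).pow 2).const_add (a ^ 2)).log hpa
      simpa using this
    have e₂ : HasDerivAt (fun u : ℝ => Real.log (b ^ 2 + (u - v) ^ 2))
        (2 * (u - v) / (b ^ 2 + (u - v) ^ 2)) u := by
      have := ((((hasDerivAt_id u).sub_const v).pow 2).const_add (b ^ 2)).log hpb
      simpa using this
    have e₃ := ((hasDerivAt_id u).div_const a).arctan
    have e₄ := (((hasDerivAt_id u).sub_const v).div_const b).arctan
    have := ((e₁.sub e₂).const_mul (A / 2)).add ((e₃.const_mul (B / a)).add (e₄.const_mul (C / b)))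
    refine this.congr_deriv ?_
    simp only [id]
    have q₁ : B / a * (1 / (1 + (u / a) ^ 2) * (1 / a)) = B / (a ^ 2 + u ^ 2) := by
      field_simp
    have q₂ : C / b * (1 / (1 + ((u - v) / b) ^ 2) * (1 / b)) = C / (b ^ 2 + (u - v) ^ 2) := by
      field_simp
    rw [q₁, q₂]
    have hcross : (A * u + B) * (b ^ 2 + (u - v) ^ 2) + (-A * (u - v) + C) * (a ^ 2 + u ^ 2)
        = a * b := by
      have : (A * u + B) * (b ^ 2 + (u - v) ^ 2) + (-A * (u - v) + C) * (a ^ 2 + u ^ 2)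
        = a * b * D / D := by
        rw [hA, hB, hC, hD]
        ring
      rw [this, mul_div_cancel_right₀ _ hD0]
    rw [div_mul_div_comm, ← hcross]
    field_simp
    ring
  have hatan : ∀ {c : ℝ} (w : ℝ), 0 < c →
      Tendsto (fun u => Real.arctan ((u - w) / c)) atTop (𝓝 (π / 2)) := fun w hc =>
    (tendsto_nhds_of_tendsto_nhdsWithin tendsto_arctan_atTop).comp
      ((tendsto_atTop_add_const_right _ (-w) tendsto_id).atTop_div_const hc)
  have hatan' : ∀ {c : ℝ} (w : ℝ), 0 < c →
      Tendsto (fun u => Real.arctan ((u - w) / c)) atBot (𝓝 (-(π / 2))) := fun w hc =>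
    (tendsto_nhds_of_tendsto_nhdsWithin tendsto_arctan_atBot).comp
      ((tendsto_atBot_add_const_right _ (-w) tendsto_id).atBot_div_const hc)
  have htop : Tendsto F atTop (𝓝 (A / 2 * 0 + (B / a * (π / 2) + C / b * (π / 2)))) := by
    refine ((tendsto_log_ratio a b v tendsto_inv_atTop_zero (eventually_ne_atTop 0) ha
      hb).const_mul _).add (((?_ : Tendsto _ _ _).const_mul _).add ((hatan v hb).const_mul _))
    simpa using hatan 0 ha
  have hbot : Tendsto F atBot (𝓝 (A / 2 * 0 + (B / a * (-(π / 2)) + C / b * (-(π / 2))))) := by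
    refine ((tendsto_log_ratio a b v tendsto_inv_atBot_zero (eventually_ne_atBot 0) ha
      hb).const_mul _).add (((?_ : Tendsto _ _ _).const_mul _).add ((hatan' v hb).const_mul _))
    simpa using hatan' 0 ha
  rw [integral_of_hasDerivAt_of_tendsto hderiv (integrable_poisson_mul ha hb v) hbot htop]
  have : A / 2 * 0 + (B / a * (π / 2) + C / b * (π / 2))
      - (A / 2 * 0 + (B / a * (-(π / 2)) + C / b * (-(π / 2))))
      = π * (a + b) * ((a - b) ^ 2 + v ^ 2) / D := by
    rw [hB, hC]
    field_simp
    ring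
  rw [this, hD, mul_div_mul_right _ _ hs.ne']

/-- The half-plane Poisson kernel with pole above height `z.2`, extended by zero below. -/
def poisson (z x : ℝ × ℝ) : ℝ :=
  if z.2 < x.2 then (x.2 - z.2) / (π * ((x.2 - z.2) ^ 2 + (x.1 - z.1) ^ 2)) else 0

lemma measurable_poisson : Measurable fun p : (ℝ × ℝ) × (ℝ × ℝ) => poisson p.1 p.2 := by
  unfold poisson
  refine Measurable.ite (measurableSet_lt (by fun_prop) (by fun_prop)) (by fun_prop) (by fun_prop)

lemma poisson_nonneg (z x : ℝ × ℝ) : 0 ≤ poisson z x := by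
  unfold poisson
  split_ifs with h
  · have := sub_pos.2 h
    positivity
  · exact le_rfl

lemma lintegral_poisson_horizontal {x y : ℝ × ℝ} (hxy : x ≠ y) {t : ℝ} (hx : t < x.2)
    (hy : t < y.2) :
    ∫⁻ s : ℝ, ENNReal.ofReal (poisson (s, t) x * poisson (s, t) y)
      = ENNReal.ofReal ((1 / π) * ((x.2 + y.2 - 2 * t) /
          ((x.2 + y.2 - 2 * t) ^ 2 + (x.1 - y.1) ^ 2))) := by
  set a := x.2 - t with ha
  set b := y.2 - t with hb
  set v := x.1 - y.1 with hv
  have ha0 : 0 < a := sub_pos.2 hx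
  have hb0 : 0 < b := sub_pos.2 hy
  have hne : a ≠ b ∨ v ≠ 0 := by
    by_contra! h
    exact hxy (Prod.ext (by linarith [h.2]) (by linarith [h.1]))
  rw [← lintegral_sub_left_eq_self _ x.1]
  have hcongr : ∀ u : ℝ, poisson (x.1 - u, t) x * poisson (x.1 - u, t) y
      = (1 / π ^ 2) * (a / (a ^ 2 + u ^ 2) * (b / (b ^ 2 + (u - v) ^ 2))) := by
    intro u
    simp only [poisson, if_pos hx, if_pos hy]
    rw [← ha, ← hb, show x.1 - (x.1 - u) = u by ring, show y.1 - (x.1 - u) = u - v by rw [hv]; ring]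
    field_simp
  simp_rw [hcongr]
  rw [← ofReal_integral_eq_lintegral_ofReal ((integrable_poisson_mul ha0 hb0 v).const_mul _)
    (ae_of_all _ fun u => by positivity), integral_const_mul, integral_poisson_mul ha0 hb0 hne,
    show x.2 + y.2 - 2 * t = a + b by rw [ha, hb]; ring]
  congr 1
  have := Real.pi_pos
  field_simp

lemma integral_G_antideriv {x y : ℝ × ℝ} (hx : x ∈ H) (hy : y ∈ H) (hxy : x ≠ y) :
    ∫⁻ t in Ioc 0 (min x.2 y.2), ENNReal.ofReal ((1 / π) * ((x.2 + y.2 - 2 * t) /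
          ((x.2 + y.2 - 2 * t) ^ 2 + (x.1 - y.1) ^ 2))) = ENNReal.ofReal (G x y) := by
  have hx' : 0 < x.2 := hx
  have hy' : 0 < y.2 := hy
  set m := min x.2 y.2 with hm
  have hm0 : 0 < m := lt_min hx hy
  have hmin : x.2 + y.2 - 2 * m = |x.2 - y.2| := by
    rw [hm, ← max_sub_min_eq_abs', ← max_add_min x.2 y.2]
    ring
  have hge : ∀ t ≤ m, |x.2 - y.2| ≤ x.2 + y.2 - 2 * t := by
    intro t ht
    rw [← hmin]
    linarith
  have hd2 : 0 < (x.2 - y.2) ^ 2 + (x.1 - y.1) ^ 2 := by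
    have := planeDist_sq x y
    have h2 := planeDist_pos hxy
    nlinarith [sq_pos_of_pos h2]
  have hden : ∀ t ≤ m, 0 < (x.2 + y.2 - 2 * t) ^ 2 + (x.1 - y.1) ^ 2 := by
    intro t ht
    have : (x.2 - y.2) ^ 2 ≤ (x.2 + y.2 - 2 * t) ^ 2 := by
      rw [← sq_abs (x.2 - y.2)]
      exact pow_le_pow_left₀ (abs_nonneg _) (hge t ht) 2
    linarith
  have hcont : ContinuousOn (fun t => (1 / π) * ((x.2 + y.2 - 2 * t) /
      ((x.2 + y.2 - 2 * t) ^ 2 + (x.1 - y.1) ^ 2))) (Icc 0 m) := by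
    refine ContinuousOn.mul continuousOn_const (ContinuousOn.div (by fun_prop) (by fun_prop) ?_)
    exact fun t ht => (hden t ht.2).ne'
  rw [← ofReal_integral_eq_lintegral_ofReal
    (hcont.integrableOn_Icc.mono_set Ioc_subset_Icc_self) ?_]
  · congr 1
    rw [← intervalIntegral.integral_of_le hm0.le,
      intervalIntegral.integral_eq_sub_of_hasDerivAt (f := fun t =>
        -(1 / (4 * π)) * Real.log ((x.2 + y.2 - 2 * t) ^ 2 + (x.1 - y.1) ^ 2))]
    · rw [hmin, sq_abs]
      unfold G
      have h0 := hden 0 hm0.le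
      rw [mul_zero, sub_zero] at h0 ⊢
      have : 1 + 4 * x.2 * y.2 / ((x.1 - y.1) ^ 2 + (x.2 - y.2) ^ 2)
          = ((x.2 + y.2) ^ 2 + (x.1 - y.1) ^ 2) / ((x.2 - y.2) ^ 2 + (x.1 - y.1) ^ 2) := by
        rw [add_comm ((x.1 - y.1) ^ 2), eq_div_iff hd2.ne', add_mul, div_mul_cancel₀ _ hd2.ne']
        ring
      rw [this, Real.log_div h0.ne' hd2.ne']
      ring
    · intro t ht
      rw [uIcc_of_le hm0.le] at ht
      have hd := hden t ht.2
      have e := ((((hasDerivAt_id t).const_mul 2).const_sub (x.2 + y.2)).pow 2).add_const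
        ((x.1 - y.1) ^ 2)
      have := (e.log hd.ne').const_mul (-(1 / (4 * π)))
      refine this.congr_deriv ?_
      simp only [id, mul_one, Pi.pow_apply]
      push_cast
      field_simp
      ring
    · exact (hcont.mono (by rw [uIcc_of_le hm0.le])).intervalIntegrable
  · filter_upwards [ae_restrict_mem measurableSet_Ioc] with t ht
    have := (abs_nonneg _).trans (hge t ht.2)
    have := hden t ht.2
    simp only [Pi.zero_apply]
    positivity

lemma lintegral_poisson_mul_poisson {x y : ℝ × ℝ} (hx : x ∈ H) (hy : y ∈ H) (hxy : x ≠ y) :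
    ∫⁻ z in H, ENNReal.ofReal (poisson z x * poisson z y) = ENNReal.ofReal (G x y) := by
  have hm : Measurable fun z : ℝ × ℝ => ENNReal.ofReal (poisson z x * poisson z y) :=
    ((measurable_poisson.comp measurable_prodMk_right).mul
      (measurable_poisson.comp measurable_prodMk_right)).ennreal_ofReal
  have hH : H = univ ×ˢ Ioi (0 : ℝ) := by
    ext z
    simp [H]
  rw [hH, Measure.volume_eq_prod, ← Measure.prod_restrict, Measure.restrict_univ,
    lintegral_prod_symm _ hm.aemeasurable, ← integral_G_antideriv hx hy hxy,
    restrict_Ioo_eq_restrict_Ioc.symm,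
    ← Ioi_inter_Iio, inter_comm, ← Measure.restrict_restrict measurableSet_Iio,
    ← lintegral_indicator measurableSet_Iio]
  apply lintegral_congr
  intro t
  by_cases ht : t < min x.2 y.2
  · rw [indicator_of_mem (show t ∈ Iio _ from ht), lintegral_poisson_horizontal hxy
      (ht.trans_le (min_le_left _ _)) (ht.trans_le (min_le_right _ _))]
  · rw [indicator_of_notMem (show t ∉ Iio _ from ht)]
    have hzero : ∀ s : ℝ, ENNReal.ofReal (poisson (s, t) x * poisson (s, t) y) = 0 := by
      intro s
      rcases min_le_iff.1 (not_lt.1 ht) with h | h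
      · simp [poisson, not_lt.2 h]
      · simp [poisson, not_lt.2 h]
    simp [hzero]

lemma ae_prod_ne (μ ν : Measure (ℝ × ℝ)) [SFinite ν] [NullSingletonClass ν] :
    ∀ᵐ p ∂μ.prod ν, p.1 ≠ p.2 := by
  have hm : MeasurableSet {p : (ℝ × ℝ) × (ℝ × ℝ) | p.1 = p.2} :=
    measurableSet_eq_fun measurable_fst measurable_snd
  refine measure_eq_zero_iff_ae_notMem.1 ((Measure.measure_prod_null hm).2
    (ae_of_all _ fun x => ?_))
  have : Prod.mk x ⁻¹' {p : (ℝ × ℝ) × (ℝ × ℝ) | p.1 = p.2} = {x} := by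
    ext y
    simp [eq_comm]
  simp [this]

lemma ae_prod_mem_H : ∀ᵐ p ∂(volume.restrict H).prod (volume.restrict H), p.1 ∈ H ∧ p.2 ∈ H :=
  (Measure.quasiMeasurePreserving_fst.ae ae_mem_H).and
    (Measure.quasiMeasurePreserving_snd.ae ae_mem_H)

/-- The Poisson transform of a function on the half plane. -/
def poissonPot (f : ℝ × ℝ → ℝ) (z : ℝ × ℝ) : ℝ := ∫ x in H, poisson z x * f x

lemma measurable_poisson_right (z : ℝ × ℝ) : Measurable fun x => poisson z x :=
  measurable_poisson.comp measurable_prodMk_left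

lemma measurable_poisson_left (x : ℝ × ℝ) : Measurable fun z => poisson z x :=
  measurable_poisson.comp measurable_prodMk_right

lemma integral_poisson_mul_poisson {x y : ℝ × ℝ} (hx : x ∈ H) (hy : y ∈ H) (hxy : x ≠ y) :
    ∫ z in H, poisson z x * poisson z y = G x y := by
  rw [integral_eq_lintegral_of_nonneg_ae
    (ae_of_all _ fun z => mul_nonneg (poisson_nonneg z x) (poisson_nonneg z y))
    ((measurable_poisson_left x).mul (measurable_poisson_left y)).aestronglyMeasurable,
    lintegral_poisson_mul_poisson hx hy hxy, ENNReal.toReal_ofReal (G_nonneg hx hy)]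

lemma Adm.integrable_poisson {f : ℝ × ℝ → ℝ} (hf : Adm f) :
    Integrable (fun q : (ℝ × ℝ) × ((ℝ × ℝ) × (ℝ × ℝ)) =>
        poisson q.1 q.2.1 * f q.2.1 * (poisson q.1 q.2.2 * f q.2.2))
      ((volume.restrict H).prod ((volume.restrict H).prod (volume.restrict H))) := by
  set μ := volume.restrict H
  have hp₁ : Measurable fun q : (ℝ × ℝ) × ((ℝ × ℝ) × (ℝ × ℝ)) => poisson q.1 q.2.1 :=
    measurable_poisson.comp
      (by fun_prop : Measurable fun q : (ℝ × ℝ) × ((ℝ × ℝ) × (ℝ × ℝ)) => (q.1, q.2.1))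
  have hp₂ : Measurable fun q : (ℝ × ℝ) × ((ℝ × ℝ) × (ℝ × ℝ)) => poisson q.1 q.2.2 :=
    measurable_poisson.comp
      (by fun_prop : Measurable fun q : (ℝ × ℝ) × ((ℝ × ℝ) × (ℝ × ℝ)) => (q.1, q.2.2))
  have hm : AEStronglyMeasurable (fun q : (ℝ × ℝ) × ((ℝ × ℝ) × (ℝ × ℝ)) =>
      poisson q.1 q.2.1 * f q.2.1 * (poisson q.1 q.2.2 * f q.2.2)) (μ.prod (μ.prod μ)) :=
    (hp₁.aestronglyMeasurable.mul (hf.integrable.1.comp_fst (ν := μ)).comp_snd).mul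
      (hp₂.aestronglyMeasurable.mul (hf.integrable.1.comp_snd (μ := μ)).comp_snd)
  refine ⟨hm, ?_⟩
  unfold HasFiniteIntegral
  rw [lintegral_prod_symm _ hm.enorm]
  refine lt_of_le_of_lt (lintegral_mono_ae ?_) (hf.integrable_interaction hf).2
  filter_upwards [ae_prod_ne _ _, ae_prod_mem_H] with p hne hp
  apply le_of_eq
  calc _ = ∫⁻ z in H, ‖f p.1 * f p.2‖ₑ * ENNReal.ofReal (poisson z p.1 * poisson z p.2) := by
        congr with z
        rw [← Real.enorm_of_nonneg (mul_nonneg (poisson_nonneg z p.1) (poisson_nonneg z p.2)),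
          ← enorm_mul]
        congr 1
        ring
    _ = ‖f p.1 * f p.2‖ₑ * ENNReal.ofReal (G p.1 p.2) := by
        rw [lintegral_const_mul' _ _ (by exact enorm_ne_top),
          lintegral_poisson_mul_poisson hp.1 hp.2 hne]
    _ = _ := by
        rw [← Real.enorm_of_nonneg (G_nonneg hp.1 hp.2), ← enorm_mul]
        congr 1
        ring

lemma poissonPot_sq (f : ℝ × ℝ → ℝ) (z : ℝ × ℝ) :
    ∫ p, poisson z p.1 * f p.1 * (poisson z p.2 * f p.2)
      ∂((volume.restrict H).prod (volume.restrict H)) = poissonPot f z ^ 2 := by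
  rw [integral_prod_mul (fun x => poisson z x * f x) (fun x => poisson z x * f x), sq]
  rfl

lemma Adm.integrable_poissonPot_sq {f : ℝ × ℝ → ℝ} (hf : Adm f) :
    Integrable (fun z => poissonPot f z ^ 2) (volume.restrict H) := by
  simp_rw [← poissonPot_sq]
  exact hf.integrable_poisson.integral_prod_left

lemma Adm.interaction_self {f : ℝ × ℝ → ℝ} (hf : Adm f) :
    interaction f f = ∫ z in H, poissonPot f z ^ 2 := by
  rw [hf.interaction_eq_integral_prod hf]
  simp_rw [← poissonPot_sq]
  rw [integral_integral_swap hf.integrable_poisson]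
  apply integral_congr_ae
  filter_upwards [ae_prod_ne _ _, ae_prod_mem_H] with p hne hp
  rw [← integral_poisson_mul_poisson hp.1 hp.2 hne, mul_assoc, ← integral_mul_const]
  congr with z
  ring

lemma Adm.interaction_self_nonneg {f : ℝ × ℝ → ℝ} (hf : Adm f) : 0 ≤ interaction f f := by
  rw [hf.interaction_self]
  exact integral_nonneg fun z => sq_nonneg _

lemma Adm.poissonPot_ae_eq_zero {f : ℝ × ℝ → ℝ} (hf : Adm f) (h : interaction f f ≤ 0) :
    poissonPot f =ᵐ[volume.restrict H] 0 := by
  have h0 := le_antisymm h hf.interaction_self_nonneg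
  rw [hf.interaction_self, integral_eq_zero_iff_of_nonneg (fun z => sq_nonneg _)
    hf.integrable_poissonPot_sq] at h0
  filter_upwards [h0] with z hz
  simpa using hz

lemma exists_affine_orthogonal {α : Type*} [MeasurableSpace α] (ν : Measure α) [IsFiniteMeasure ν]
    {a y : α → ℝ} {C D : ℝ} (ha : Measurable a) (hy : Measurable y) (hC : ∀ᵐ x ∂ν, |a x| ≤ C)
    (hD : ∀ᵐ x ∂ν, |y x| ≤ D) :
    ∃ p q : ℝ, (∫ x, (a x - (p + q * y x)) ∂ν = 0) ∧ ∫ x, y x * (a x - (p + q * y x)) ∂ν = 0 := by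
  have ia : Integrable a ν := Integrable.of_bound ha.aestronglyMeasurable C hC
  have iy : Integrable y ν := Integrable.of_bound hy.aestronglyMeasurable D hD
  rcases eq_or_ne ν 0 with rfl | hν
  · exact ⟨0, 0, by simp, by simp⟩
  have hm : ν.real univ ≠ 0 := by
    rw [measureReal_def, ENNReal.toReal_ne_zero]
    exact ⟨by simpa using hν, measure_ne_top _ _⟩
  set e := (∫ x, y x ∂ν) / ν.real univ with he
  set y' : α → ℝ := fun x => y x - e with hy'
  have iy' : Integrable y' ν := iy.sub (integrable_const e)
  have bdd : ∀ᵐ x ∂ν, ‖y' x‖ ≤ D + |e| := by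
    filter_upwards [hD] with x hx
    exact (norm_sub_le _ _).trans (add_le_add hx le_rfl)
  have iy'2 : Integrable (fun x => y' x * y' x) ν := iy'.mul_bdd iy'.1 bdd
  have iay' : Integrable (fun x => a x * y' x) ν := ia.mul_bdd iy'.1 bdd
  have hy'0 : ∫ x, y' x ∂ν = 0 := by
    rw [hy', integral_sub iy (integrable_const e), integral_const, he, smul_eq_mul]
    field_simp
    ring
  set q := (∫ x, a x * y' x ∂ν) / ∫ x, y' x * y' x ∂ν with hq
  set p := (∫ x, a x ∂ν) / ν.real univ with hp
  have hqmul : ∫ x, a x * y' x ∂ν = q * ∫ x, y' x * y' x ∂ν := by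
    by_cases hV : ∫ x, y' x * y' x ∂ν = 0
    · rw [hV, mul_zero]
      rw [integral_eq_zero_iff_of_nonneg (fun x => mul_self_nonneg _) iy'2] at hV
      apply integral_eq_zero_of_ae
      filter_upwards [hV] with x hx
      have : y' x = 0 := by simpa using hx
      simp [this]
    · rw [hq, div_mul_cancel₀ _ hV]
  have ires : Integrable (fun x => a x - p - q * y' x) ν :=
    (ia.sub (integrable_const p)).sub (iy'.const_mul q)
  have iap : Integrable (fun x => a x - p) ν := ia.sub (integrable_const p)
  have iayp : Integrable (fun x => a x * y' x - p * y' x) ν := iay'.sub (iy'.const_mul p)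
  have h₁ : ∫ x, (a x - p - q * y' x) ∂ν = 0 := by
    rw [integral_sub iap (iy'.const_mul q),
      integral_sub ia (integrable_const p), integral_const_mul, hy'0, integral_const, hp,
      smul_eq_mul]
    field_simp
    ring
  have h₂ : ∫ x, y' x * (a x - p - q * y' x) ∂ν = 0 := by
    have : ∀ x, y' x * (a x - p - q * y' x) = a x * y' x - p * y' x - q * (y' x * y' x) :=
      fun x => by ring
    simp_rw [this]
    rw [integral_sub iayp (iy'2.const_mul q),
      integral_sub iay' (iy'.const_mul p), integral_const_mul, integral_const_mul, hy'0, hqmul]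
    ring
  have hre : ∀ x, a x - (p - q * e + q * y x) = a x - p - q * y' x := fun x => by
    rw [hy']
    ring
  refine ⟨p - q * e, q, ?_, ?_⟩
  · simp_rw [hre]
    exact h₁
  · simp_rw [hre]
    have : ∀ x, y x * (a x - p - q * y' x)
        = y' x * (a x - p - q * y' x) + e * (a x - p - q * y' x) := fun x => by
      rw [hy']
      ring
    simp_rw [this]
    rw [integral_add (ires.mul_bdd iy'.1 bdd |>.congr (ae_of_all _ fun x => mul_comm _ _))
      (ires.const_mul e), h₂, integral_const_mul, h₁]
    ring

lemma volume_poisson_eq_affine (t p q : ℝ) :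
    volume {x : ℝ × ℝ | t < x.2 ∧ poisson (0, t) x = p + q * x.2} = 0 := by
  have hm : MeasurableSet {x : ℝ × ℝ | t < x.2 ∧ poisson (0, t) x = p + q * x.2} :=
    (measurableSet_lt measurable_const measurable_snd).inter
      (measurableSet_eq_fun (measurable_poisson_right _) (by fun_prop))
  rw [Measure.volume_eq_prod, Measure.prod_apply_symm hm]
  refine (lintegral_congr fun y => ?_).trans lintegral_zero
  by_cases hy : t < y
  swap
  · simp [hy]
  refine measure_mono_null (t := {√((y - t) / (π * (p + q * y)) - (y - t) ^ 2),
    -√((y - t) / (π * (p + q * y)) - (y - t) ^ 2)}) ?_ (Set.Finite.measure_zero (by simp) _)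
  rintro s ⟨-, hs⟩
  have hy' := sub_pos.2 hy
  have hpi := Real.pi_pos
  simp only [poisson, if_pos hy, sub_zero] at hs
  have hsq : (y - t) / (π * (p + q * y)) - (y - t) ^ 2 = s ^ 2 := by
    rw [← hs]
    field_simp
    ring
  rw [hsq, Real.sqrt_sq_eq_abs]
  rcases abs_choice s with h | h <;> simp [h]

lemma poisson_le {z x : ℝ × ℝ} {d : ℝ} (hd : 0 < d) (h : z.2 + d ≤ x.2) :
    poisson z x ≤ 1 / (π * d) := by
  have hb : d ≤ x.2 - z.2 := by linarith
  have hb0 : 0 < x.2 - z.2 := by linarith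
  have hpi := Real.pi_pos
  rw [poisson, if_pos (by linarith), div_le_div_iff₀ (by positivity) (by positivity)]
  have : d * (x.2 - z.2) ≤ (x.2 - z.2) ^ 2 + (x.1 - z.1) ^ 2 := by
    nlinarith [sq_nonneg (x.1 - z.1)]
  nlinarith

lemma continuousOn_poisson (x : ℝ × ℝ) : ContinuousOn (fun z => poisson z x) {z | z.2 < x.2} := by
  have : ContinuousOn (fun z : ℝ × ℝ =>
      (x.2 - z.2) / (π * ((x.2 - z.2) ^ 2 + (x.1 - z.1) ^ 2))) {z | z.2 < x.2} := by
    refine ContinuousOn.div (by fun_prop) (by fun_prop) fun z hz => ?_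
    have : 0 < x.2 - z.2 := sub_pos.2 hz
    have := Real.pi_pos
    positivity
  exact this.congr fun z hz => if_pos hz

lemma continuousOn_poissonPot {g : ℝ × ℝ → ℝ} (hg : Integrable g (volume.restrict H)) {δ d : ℝ}
    (hd : d < δ) (h0 : ∀ x, x.2 < δ → g x = 0) :
    ContinuousOn (poissonPot g) {z | z.2 < d} := by
  refine continuousOn_of_dominated (bound := fun x => 1 / (π * (δ - d)) * ‖g x‖)
    (fun z _ => (measurable_poisson_right z).aestronglyMeasurable.mul hg.1)
    (fun z hz => ae_of_all _ fun x => ?_) (hg.norm.const_mul _) (ae_of_all _ fun x => ?_)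
  · rcases lt_or_ge x.2 δ with hx | hx
    · simp [h0 x hx]
    · have hz : z.2 < d := hz
      rw [norm_mul, Real.norm_of_nonneg (poisson_nonneg z x)]
      gcongr
      exact poisson_le (sub_pos.2 hd) (by linarith)
  · rcases lt_or_ge x.2 δ with hx | hx
    · simp only [h0 x hx, mul_zero]
      exact continuousOn_const
    · exact ((continuousOn_poisson x).mono fun z hz => (lt_trans hz hd).trans_le hx).mul
        continuousOn_const

lemma setIntegral_H_indicator {S : Set (ℝ × ℝ)} (hS : MeasurableSet S) (hSH : S ⊆ H)
    (f : ℝ × ℝ → ℝ) : ∫ x in H, S.indicator f x = ∫ x in S, f x := by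
  rw [setIntegral_indicator hS, inter_eq_self_of_subset_right hSH]

lemma exists_positive_perturbation {S : Set (ℝ × ℝ)} {N δ : ℝ} (hS : MeasurableSet S) (hδ : 0 < δ)
    (hsub : ∀ x ∈ S, |x.1| ≤ N ∧ δ ≤ x.2 ∧ x.2 ≤ N) (hpos : volume S ≠ 0) :
    ∃ (g : ℝ × ℝ → ℝ) (C : ℝ), Adm g ∧ (∀ x, |g x| ≤ C) ∧ (∀ x ∉ S, g x = 0) ∧
      ∫ x in H, g x = 0 ∧ ∫ x in H, x.2 * g x = 0 ∧ 0 < interaction g g := by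
  have hSH : S ⊆ H := fun x hx => hδ.trans_le (hsub x hx).2.1
  have hfin : volume S ≠ ⊤ := by
    refine ((measure_mono (t := Icc (-N) N ×ˢ Icc δ N) fun x hx => ?_).trans_lt ?_).ne
    · exact ⟨abs_le.1 (hsub x hx).1, (hsub x hx).2⟩
    · rw [Measure.volume_eq_prod, Measure.prod_prod]
      exact ENNReal.mul_lt_top (by simp) (by simp)
  have : IsFiniteMeasure (volume.restrict S) := ⟨by simpa using hfin.lt_top⟩
  have hmem : ∀ᵐ x ∂volume.restrict S, x ∈ S := ae_restrict_mem hS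
  set a : ℝ × ℝ → ℝ := fun x => poisson (0, δ / 2) x with ha
  have hma : Measurable a := measurable_poisson_right _
  have hab : ∀ x ∈ S, |a x| ≤ 1 / (π * (δ / 2)) := fun x hx => by
    rw [abs_of_nonneg (poisson_nonneg _ _)]
    exact poisson_le (by positivity) (by have := (hsub x hx).2.1; simp only; linarith)
  obtain ⟨p, q, h₁, h₂⟩ := exists_affine_orthogonal (volume.restrict S) (C := 1 / (π * (δ / 2)))
    (D := N) hma measurable_snd (hmem.mono fun x hx => hab x hx)
    (hmem.mono fun x hx => by
      rw [abs_of_pos (hSH hx)]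
      exact (hsub x hx).2.2)
  set r : ℝ × ℝ → ℝ := fun x => a x - (p + q * x.2) with hr
  set C := 1 / (π * (δ / 2)) + (|p| + |q| * |N|) with hC
  have hmr : Measurable r := by fun_prop
  have hrb : ∀ x ∈ S, |r x| ≤ C := fun x hx => by
    refine (abs_sub _ _).trans (add_le_add (hab x hx) ((abs_add_le _ _).trans ?_))
    have hy : |x.2| ≤ |N| := by
      rw [abs_of_pos (hSH hx)]
      exact (hsub x hx).2.2.trans (le_abs_self N)
    rw [abs_mul]
    gcongr
  have hgb : ∀ x, |S.indicator r x| ≤ C := fun x => by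
    by_cases hx : x ∈ S
    · rw [indicator_of_mem hx]
      exact hrb x hx
    · rw [indicator_of_notMem hx, abs_zero]
      have := Real.pi_pos
      positivity
  have hrint : Integrable r (volume.restrict S) :=
    Integrable.of_bound hmr.aestronglyMeasurable C (hmem.mono fun x hx => hrb x hx)
  have hyb : ∀ᵐ x ∂volume.restrict S, ‖x.2‖ ≤ N := hmem.mono fun x hx => by
    rw [Real.norm_of_nonneg (hSH hx).le]
    exact (hsub x hx).2.2
  have hyrint : Integrable (fun x => x.2 * r x) (volume.restrict S) :=
    hrint.bdd_mul measurable_snd.aestronglyMeasurable hyb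
  have himp : (fun x : ℝ × ℝ => x.2 * S.indicator r x) = S.indicator fun x => x.2 * r x := by
    ext x
    by_cases hx : x ∈ S <;> simp [hx]
  have hind : ∀ f : ℝ × ℝ → ℝ, Integrable f (volume.restrict S) →
      Integrable (S.indicator f) (volume.restrict H) := fun f hf =>
    ((integrable_indicator_iff hS).2 hf).mono_measure Measure.restrict_le_self
  have hadm : Adm (S.indicator r) := ⟨hind r hrint, ⟨C, ae_of_all _ hgb⟩, by
    rw [himp]
    exact hind _ hyrint⟩
  refine ⟨S.indicator r, C, hadm, hgb, fun x hx => indicator_of_notMem hx _, ?_, ?_, ?_⟩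
  · rw [setIntegral_H_indicator hS hSH]
    exact h₁
  · rw [himp, setIntegral_H_indicator hS hSH]
    exact h₂
  by_contra! hle
  have hae := hadm.poissonPot_ae_eq_zero hle
  set U : Set (ℝ × ℝ) := H ∩ {z | z.2 < 3 * δ / 4} with hU
  have hUo : IsOpen U := (isOpen_lt continuous_const continuous_snd).inter
    (isOpen_lt continuous_snd continuous_const)
  have hcont : ContinuousOn (poissonPot (S.indicator r)) U :=
    (continuousOn_poissonPot hadm.integrable (δ := δ) (by linarith) fun x hx =>
      indicator_of_notMem (fun h => hx.not_ge (hsub x h).2.1) _).mono inter_subset_right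
  have hzero := Measure.eqOn_open_of_ae_eq (ae_restrict_of_ae_restrict_of_subset inter_subset_left
    hae) hUo hcont continuousOn_const (x := ((0, δ / 2) : ℝ × ℝ))
    ⟨half_pos hδ, by simp only [mem_ofPred_eq]; linarith⟩
  have har : ∫ x in S, a x * r x = 0 := by
    rw [← setIntegral_H_indicator hS hSH]
    refine Eq.trans ?_ hzero
    unfold poissonPot
    congr with x
    by_cases hx : x ∈ S <;> simp [hx, ha]
  have harint : Integrable (fun x => a x * r x) (volume.restrict S) :=
    hrint.bdd_mul hma.aestronglyMeasurable (hmem.mono fun x hx => hab x hx)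
  have hrr : (fun x => r x ^ 2) = fun x => a x * r x - (p * r x + q * (x.2 * r x)) := by
    ext x
    simp only [hr]
    ring
  have hsum : Integrable (fun x => p * r x + q * (x.2 * r x)) (volume.restrict S) :=
    (hrint.const_mul p).add (hyrint.const_mul q)
  have hsq : ∫ x in S, r x ^ 2 = 0 := by
    rw [hrr, integral_sub harint hsum, integral_add (hrint.const_mul p) (hyrint.const_mul q),
      integral_const_mul, integral_const_mul, har, h₁, h₂]
    ring
  rw [integral_eq_zero_iff_of_nonneg (fun x => sq_nonneg _)
    (by rw [hrr]; exact harint.sub hsum)] at hsq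
  apply hpos
  have hnull : ∀ᵐ x ∂volume.restrict S, False := by
    filter_upwards [hsq, hmem, ae_restrict_of_ae
      (measure_eq_zero_iff_ae_notMem.1 (volume_poisson_eq_affine (δ / 2) p q))] with x hx hxS hxn
    have : r x = 0 := by simpa using hx
    exact hxn ⟨by have := (hsub x hxS).2.1; linarith, sub_eq_zero.1 this⟩
  simpa using hnull

/-- The mass of `W` in the horizontal cell `[kε, (k+1)ε)` at height `y`. -/
def cellMass (ε : ℝ) (W : ℝ × ℝ → ENNReal) (k : ℤ) (y : ℝ) : ENNReal :=
  ∫⁻ s in Ico (k • ε) ((k + 1) • ε), W (s, y)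

/-- In each horizontal cell of length `ε`, the interval starting at the left end whose length is
the mass of `W` in the cell. -/
def patchApprox (ε : ℝ) (W : ℝ × ℝ → ENNReal) : Set (ℝ × ℝ) :=
  ⋃ k : ℤ, {x | k • ε ≤ x.1 ∧ x.1 < k • ε + (cellMass ε W k x.2).toReal}

lemma measurable_cellMass (ε : ℝ) {W : ℝ × ℝ → ENNReal} (hW : Measurable W) (k : ℤ) :
    Measurable (cellMass ε W k) :=
  hW.lintegral_prod_left'

lemma measurableSet_patchApprox (ε : ℝ) {W : ℝ × ℝ → ENNReal} (hW : Measurable W) :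
    MeasurableSet (patchApprox ε W) :=
  MeasurableSet.iUnion fun k =>
    (measurableSet_le measurable_const measurable_fst).inter
      (measurableSet_lt measurable_fst (measurable_const.add
        ((measurable_cellMass ε hW k).comp measurable_snd).ennreal_toReal))

lemma cellMass_le {ε : ℝ} {W : ℝ × ℝ → ENNReal} (hW : ∀ x, W x ≤ 1) (k : ℤ) (y : ℝ) :
    cellMass ε W k y ≤ ENNReal.ofReal ε := by
  calc cellMass ε W k y ≤ ∫⁻ _ in Ico (k • ε) ((k + 1) • ε), 1 := lintegral_mono fun s => hW _
    _ = ENNReal.ofReal ε := by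
      rw [setLIntegral_one, Real.volume_Ico]
      congr 1
      rw [add_smul, one_smul, add_sub_cancel_left]

/-- The interval of `patchApprox` in a given cell and at a given height. -/
def cellInterval (ε : ℝ) (W : ℝ × ℝ → ENNReal) (y : ℝ) (k : ℤ) : Set ℝ :=
  Ico (k • ε) (k • ε + (cellMass ε W k y).toReal)

lemma patchApprox_slice (ε : ℝ) (W : ℝ × ℝ → ENNReal) (y : ℝ) :
    (fun s : ℝ => (s, y)) ⁻¹' patchApprox ε W = ⋃ k, cellInterval ε W y k := by
  ext s
  simp [patchApprox, cellInterval]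

lemma volume_cellInterval {ε : ℝ} {W : ℝ × ℝ → ENNReal} (hW : ∀ x, W x ≤ 1) (k : ℤ) (y : ℝ) :
    volume (cellInterval ε W y k) = cellMass ε W k y := by
  rw [cellInterval, Real.volume_Ico, add_sub_cancel_left,
    ENNReal.ofReal_toReal ((cellMass_le hW k y).trans_lt ENNReal.ofReal_lt_top).ne]

lemma cellInterval_subset {ε : ℝ} (hε : 0 < ε) {W : ℝ × ℝ → ENNReal} (hW : ∀ x, W x ≤ 1) (k : ℤ)
    (y : ℝ) : cellInterval ε W y k ⊆ Ico (k • ε) ((k + 1) • ε) := by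
  apply Ico_subset_Ico_right
  rw [add_smul, one_smul]
  gcongr
  exact ENNReal.toReal_le_of_le_ofReal hε.le (cellMass_le hW k y)

lemma lintegral_eq_tsum_cell {ε : ℝ} (hε : 0 < ε) (f : ℝ → ENNReal) :
    ∫⁻ s, f s = ∑' k : ℤ, ∫⁻ s in Ico (k • ε) ((k + 1) • ε), f s := by
  rw [← lintegral_iUnion (fun k => measurableSet_Ico) (pairwise_disjoint_Ico_zsmul ε),
    iUnion_Ico_zsmul hε, Measure.restrict_univ]

lemma lintegral_slice {ε : ℝ} (hε : 0 < ε) {W : ℝ × ℝ → ENNReal} (hW : ∀ x, W x ≤ 1) (y : ℝ)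
    (f : ℝ → ENNReal) :
    ∫⁻ s in (fun s : ℝ => (s, y)) ⁻¹' patchApprox ε W, f s
      = ∑' k, ∫⁻ s in cellInterval ε W y k, f s := by
  rw [patchApprox_slice]
  refine lintegral_iUnion (fun k => measurableSet_Ico) ?_ f
  exact fun i j hij => (pairwise_disjoint_Ico_zsmul ε hij).mono
    (cellInterval_subset hε hW i y) (cellInterval_subset hε hW j y)

lemma lintegral_patchApprox {ε : ℝ} {W : ℝ × ℝ → ENNReal} (hm : Measurable W)
    {Φ : ℝ × ℝ → ENNReal} (hΦ : Measurable Φ) :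
    ∫⁻ x in patchApprox ε W, Φ x
      = ∫⁻ y, ∫⁻ s in (fun s : ℝ => (s, y)) ⁻¹' patchApprox ε W, Φ (s, y) := by
  have hA := measurableSet_patchApprox ε hm
  rw [← lintegral_indicator hA, Measure.volume_eq_prod,
    lintegral_prod_symm _ (hΦ.indicator hA).aemeasurable]
  congr with y
  rw [← lintegral_indicator (hA.preimage measurable_prodMk_right)]
  rfl

lemma lintegral_patchApprox_snd {ε : ℝ} (hε : 0 < ε) {W : ℝ × ℝ → ENNReal} (hm : Measurable W)
    (hW : ∀ x, W x ≤ 1) {g : ℝ → ENNReal} (hg : Measurable g) :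
    ∫⁻ x in patchApprox ε W, g x.2 = ∫⁻ x, g x.2 * W x := by
  have hg' : Measurable fun x : ℝ × ℝ => g x.2 := hg.comp measurable_snd
  rw [lintegral_patchApprox hm hg', Measure.volume_eq_prod,
    lintegral_prod_symm (fun x : ℝ × ℝ => g x.2 * W x) (hg'.mul hm).aemeasurable]
  congr with y
  have hmy : Measurable fun s => W (s, y) := hm.comp measurable_prodMk_right
  simp only
  rw [lintegral_slice hε hW, lintegral_const_mul _ hmy, lintegral_eq_tsum_cell hε,
    ← ENNReal.tsum_mul_left]
  congr with k
  rw [setLIntegral_const, volume_cellInterval hW]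
  rfl

lemma lintegral_mul_le_patchApprox {ε : ℝ} (hε : 0 < ε) {W : ℝ × ℝ → ENNReal} (hm : Measurable W)
    (hW : ∀ x, W x ≤ 1) {Φ : ℝ × ℝ → ENNReal} (hΦ : Measurable Φ) {c : ENNReal}
    (h : ∀ a b y, |a - b| ≤ ε → Φ (a, y) ≤ Φ (b, y) + c) :
    ∫⁻ x, Φ x * W x ≤ (∫⁻ x in patchApprox ε W, Φ x) + c * ∫⁻ x, W x := by
  rw [lintegral_patchApprox hm hΦ, Measure.volume_eq_prod,
    lintegral_prod_symm (fun x => Φ x * W x) (hΦ.mul hm).aemeasurable,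
    lintegral_prod_symm _ hm.aemeasurable,
    ← lintegral_const_mul c hm.lintegral_prod_left', ← lintegral_add_right _
      (hm.lintegral_prod_left'.const_mul c)]
  refine lintegral_mono fun y => ?_
  have hmy : Measurable fun s => W (s, y) := hm.comp measurable_prodMk_right
  simp only
  rw [lintegral_slice hε hW, lintegral_eq_tsum_cell hε, lintegral_eq_tsum_cell hε,
    ← ENNReal.tsum_mul_left, ← ENNReal.tsum_add]
  refine ENNReal.tsum_le_tsum fun k => ?_
  set I := ⨅ s ∈ Ico (k • ε) ((k + 1) • ε), Φ (s, y) with hI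
  have hle : ∀ s ∈ Ico (k • ε) ((k + 1) • ε), Φ (s, y) ≤ I + c := fun s hs => by
    rw [← tsub_le_iff_right]
    refine le_iInf₂ fun t ht => tsub_le_iff_right.2 (h s t y ?_)
    have hk : (k + 1) • ε = k • ε + ε := by rw [add_smul, one_smul]
    rw [hk] at hs ht
    rw [abs_le]
    constructor <;> linarith [hs.1, hs.2, ht.1, ht.2]
  calc ∫⁻ s in Ico (k • ε) ((k + 1) • ε), Φ (s, y) * W (s, y)
      ≤ ∫⁻ s in Ico (k • ε) ((k + 1) • ε), (I + c) * W (s, y) :=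
        setLIntegral_mono' measurableSet_Ico fun s hs => by
          gcongr
          exact hle s hs
    _ = I * cellMass ε W k y + c * cellMass ε W k y := by
        rw [lintegral_const_mul _ hmy, add_mul]
        rfl
    _ ≤ _ := by
        refine add_le_add_left ?_ _
        rw [← volume_cellInterval hW, ← setLIntegral_const]
        exact setLIntegral_mono' measurableSet_Ico fun s hs =>
          iInf₂_le s (cellInterval_subset hε hW k y hs)

lemma patchApprox_subset_H {ε : ℝ} {W : ℝ × ℝ → ENNReal} (h0 : ∀ x ∉ H, W x = 0) :
    patchApprox ε W ⊆ H := by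
  intro x hx
  obtain ⟨k, hk₁, hk₂⟩ := mem_iUnion.1 hx
  by_contra hxH
  have : cellMass ε W k x.2 = 0 := by
    unfold cellMass
    rw [lintegral_congr fun s => h0 (s, x.2) hxH, lintegral_zero]
  rw [this, ENNReal.toReal_zero, add_zero] at hk₂
  exact hk₁.not_gt hk₂

/-- Measurable densities on the half plane with values in `[0, 1]`, extended by zero. -/
structure Density (W : ℝ × ℝ → ENNReal) : Prop where
  measurable : Measurable W
  le_one : ∀ x, W x ≤ 1
  eq_zero : ∀ x ∉ H, W x = 0

namespace Density

variable {W : ℝ × ℝ → ENNReal}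

lemma ne_top (hW : Density W) (x : ℝ × ℝ) : W x ≠ ⊤ :=
  ((hW.le_one x).trans_lt ENNReal.one_lt_top).ne

lemma toReal_le_one (hW : Density W) (x : ℝ × ℝ) : (W x).toReal ≤ 1 :=
  ENNReal.toReal_le_of_le_ofReal zero_le_one (by simpa using hW.le_one x)

lemma enorm_toReal (hW : Density W) (x : ℝ × ℝ) : ‖(W x).toReal‖ₑ = W x := by
  rw [Real.enorm_of_nonneg ENNReal.toReal_nonneg, ENNReal.ofReal_toReal (hW.ne_top x)]

lemma setLIntegral_mul (hW : Density W) (f : ℝ × ℝ → ENNReal) :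
    ∫⁻ x in H, f x * W x = ∫⁻ x, f x * W x := by
  rw [← lintegral_indicator measurableSet_H]
  congr with x
  by_cases hx : x ∈ H
  · rw [indicator_of_mem hx]
  · rw [indicator_of_notMem hx, hW.eq_zero x hx, mul_zero]

lemma setLIntegral (hW : Density W) : ∫⁻ x in H, W x = ∫⁻ x, W x := by
  simpa using hW.setLIntegral_mul 1

lemma setLIntegral_enorm_snd_mul (hW : Density W) :
    ∫⁻ x in H, ‖x.2 * |(W x).toReal|‖ₑ = ∫⁻ x, ENNReal.ofReal x.2 * W x := by
  rw [← hW.setLIntegral_mul]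
  refine setLIntegral_congr_fun measurableSet_H fun x hx => ?_
  have hx' : 0 < x.2 := hx
  rw [enorm_mul, Real.enorm_abs, hW.enorm_toReal, Real.enorm_of_nonneg hx'.le]

lemma memKt (hW : Density W) {M : ℝ} (hM : 0 ≤ M) (hmass : ∫⁻ x, W x ≤ 1)
    (himp : ∫⁻ x, ENNReal.ofReal x.2 * W x ≤ ENNReal.ofReal M) :
    memKt M fun x => (W x).toReal := by
  have hm : Measurable fun x => (W x).toReal := hW.measurable.ennreal_toReal
  have h₁ : ∫⁻ x in H, ‖(W x).toReal‖ₑ ≤ 1 := by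
    simp_rw [hW.enorm_toReal]
    rwa [hW.setLIntegral]
  have h₂ : ∫⁻ x in H, ‖x.2 * |(W x).toReal|‖ₑ ≤ ENNReal.ofReal M := by
    rwa [hW.setLIntegral_enorm_snd_mul]
  have i₁ : Integrable (fun x => (W x).toReal) (volume.restrict H) :=
    ⟨hm.aestronglyMeasurable, h₁.trans_lt ENNReal.one_lt_top⟩
  have i₂ : Integrable (fun x : ℝ × ℝ => x.2 * |(W x).toReal|) (volume.restrict H) :=
    ⟨Measurable.aestronglyMeasurable (by fun_prop), h₂.trans_lt ENNReal.ofReal_lt_top⟩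
  refine ⟨i₁, ae_of_all _ fun x => ⟨ENNReal.toReal_nonneg, hW.toReal_le_one x⟩, ?_, i₂, ?_⟩
  · rw [← ENNReal.ofReal_le_ofReal_iff zero_le_one, ENNReal.ofReal_one]
    exact (ofReal_integral_norm_eq_lintegral_enorm i₁).trans_le h₁
  · rw [← ENNReal.ofReal_le_ofReal_iff hM]
    refine le_trans (ENNReal.ofReal_le_ofReal ((le_abs_self _).trans
      (norm_integral_le_integral_norm fun x : ℝ × ℝ => x.2 * |(W x).toReal|))) ?_
    exact (ofReal_integral_norm_eq_lintegral_enorm i₂).trans_le h₂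

end Density

lemma memKt.exists_density {M : ℝ} {ω : ℝ × ℝ → ℝ} (h : memKt M ω) :
    ∃ W, Density W ∧ ω =ᵐ[volume.restrict H] (fun x => (W x).toReal) ∧ ∫⁻ x, W x ≤ 1 ∧
      ∫⁻ x, ENNReal.ofReal x.2 * W x = ENNReal.ofReal (impulse ω) := by
  obtain ⟨h₁, h₂, h₃, h₄, h₅⟩ := h
  set W : ℝ × ℝ → ENNReal := H.indicator fun x => min (ENNReal.ofReal (h₁.1.mk ω x)) 1 with hWdef
  have hW : Density W := by
    refine ⟨?_, fun x => ?_, fun x hx => indicator_of_notMem hx _⟩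
    · exact (h₁.1.stronglyMeasurable_mk.measurable.ennreal_ofReal.min
        measurable_const).indicator measurableSet_H
    · by_cases hx : x ∈ H <;> simp [hWdef, hx]
  have hae : ω =ᵐ[volume.restrict H] fun x => (W x).toReal := by
    filter_upwards [h₁.1.ae_eq_mk, h₂, ae_mem_H] with x hx hx01 hxH
    rw [hWdef, indicator_of_mem hxH, ← hx, min_eq_left (by simpa using hx01.2),
      ENNReal.toReal_ofReal hx01.1]
  refine ⟨W, hW, hae, ?_, ?_⟩
  · have : ∫⁻ x, W x = ∫⁻ x in H, ‖ω x‖ₑ := by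
      rw [← hW.setLIntegral]
      exact lintegral_congr_ae (hae.mono fun x hx => by simp only [hx, hW.enorm_toReal])
    rw [this, ← ofReal_integral_norm_eq_lintegral_enorm h₁]
    exact ENNReal.ofReal_le_one.2 h₃
  · have : ∫⁻ x, ENNReal.ofReal x.2 * W x = ∫⁻ x in H, ‖x.2 * |ω x|‖ₑ := by
      rw [← hW.setLIntegral_enorm_snd_mul]
      exact lintegral_congr_ae (hae.mono fun x hx => by simp only [hx])
    rw [this, ← ofReal_integral_norm_eq_lintegral_enorm h₄]
    congr 1
    refine integral_congr_ae (ae_mem_H.mono fun x hx => ?_)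
    have hx' : 0 < x.2 := hx
    simp [abs_of_pos hx']

lemma Gpot_nonneg {w : ℝ × ℝ → ℝ} (hw : ∀ x, 0 ≤ w x) {x : ℝ × ℝ} (hx : x ∈ H) :
    0 ≤ Gpot w x :=
  integral_nonneg_of_ae (ae_mem_H.mono fun y hy => mul_nonneg (G_nonneg hx hy) (hw y))

lemma measurable_Gpot {w : ℝ × ℝ → ℝ} (hw : Measurable w) : Measurable (Gpot w) := by
  have : StronglyMeasurable fun z : (ℝ × ℝ) × (ℝ × ℝ) => G z.1 z.2 * w z.2 :=
    (measurable_G.mul (hw.comp measurable_snd)).stronglyMeasurable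
  exact this.integral_prod_right.measurable

lemma Adm.exists_Gpot_lipschitz {w : ℝ × ℝ → ℝ} (hw : Adm w) :
    ∃ C : ℝ, 0 ≤ C ∧ ∀ a b c : ℝ, 0 < c → |Gpot w (a, c) - Gpot w (b, c)| ≤ C * |a - b| := by
  obtain ⟨C, hC, h⟩ := hw.exists_lintegral_le
  refine ⟨C + C, by positivity, fun a b c hc => ?_⟩
  unfold Gpot
  rw [← integral_sub (hw.integrable_G_mul (show (a, c) ∈ H from hc))
    (hw.integrable_G_mul (show (b, c) ∈ H from hc))]
  have hne : ∀ z : ℝ × ℝ, ∀ᵐ y ∂volume.restrict H, z ≠ y := fun z =>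
    ae_restrict_of_ae ((measure_eq_zero_iff_ae_notMem.1 (measure_singleton z)).mono
      fun y hy h => hy h.symm)
  have hm : ∀ z : ℝ × ℝ, AEMeasurable (fun y => ‖w y‖ₑ * ENNReal.ofReal (1 / planeDist z y))
      (volume.restrict H) := fun z =>
    hw.integrable.1.enorm.mul (((measurable_planeDist.comp
      measurable_prodMk_left).const_div 1).ennreal_ofReal).aemeasurable
  have key : ‖∫ y in H, (G (a, c) y * w y - G (b, c) y * w y)‖ₑ
      ≤ ENNReal.ofReal ((C + C) * |a - b|) := by
    calc _ ≤ ∫⁻ y in H, ‖G (a, c) y * w y - G (b, c) y * w y‖ₑ :=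
          enorm_integral_le_lintegral_enorm _
      _ ≤ ∫⁻ y in H, ENNReal.ofReal |a - b| *
            (‖w y‖ₑ * ENNReal.ofReal (1 / planeDist (a, c) y)
              + ‖w y‖ₑ * ENNReal.ofReal (1 / planeDist (b, c) y)) := by
          apply lintegral_mono_ae
          filter_upwards [ae_mem_H, hne (a, c), hne (b, c)] with y hy h₁ h₂
          have hda := planeDist_pos h₁
          have hdb := planeDist_pos h₂
          rw [← sub_mul, enorm_mul, mul_comm, ← mul_add, mul_left_comm,
            ← ENNReal.ofReal_add (by positivity) (by positivity),
            ← ENNReal.ofReal_mul (abs_nonneg _)]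
          gcongr
          rw [← ofReal_norm]
          exact ENNReal.ofReal_le_ofReal (abs_G_sub_G_le hc hy h₁ h₂)
      _ ≤ ENNReal.ofReal |a - b| * (ENNReal.ofReal C + ENNReal.ofReal C) := by
          rw [lintegral_const_mul' _ _ ENNReal.ofReal_ne_top, lintegral_add_left' (hm _)]
          gcongr
          · exact h _
          · exact h _
      _ = _ := by
          rw [← ENNReal.ofReal_add hC hC, ← ENNReal.ofReal_mul (abs_nonneg _), mul_comm]
  rw [← ofReal_norm] at key
  exact (ENNReal.ofReal_le_ofReal_iff (by positivity)).1 key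

lemma Adm.integrable_Gpot_mul {f g : ℝ × ℝ → ℝ} (hf : Adm f) (hg : Adm g) :
    Integrable (fun x => Gpot g x * f x) (volume.restrict H) := by
  refine (hf.integrable_interaction hg).integral_prod_left.congr (ae_of_all _ fun x => ?_)
  simp only [Gpot]
  rw [← integral_mul_const]
  congr with y
  ring

namespace Density

variable {W V : ℝ × ℝ → ENNReal}

lemma ofReal_interaction (hW : Density W) (aW : Adm fun x => (W x).toReal)
    (aV : Adm fun x => (V x).toReal) :
    ENNReal.ofReal (interaction (fun x => (W x).toReal) fun x => (V x).toReal)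
      = ∫⁻ x, H.indicator (fun x => ENNReal.ofReal (Gpot (fun x => (V x).toReal) x)) x * W x := by
  rw [interaction_eq_integral_Gpot, ofReal_integral_eq_lintegral_ofReal
    (aW.integrable_Gpot_mul aV), ← hW.setLIntegral_mul]
  · refine setLIntegral_congr_fun measurableSet_H fun x hx => ?_
    rw [indicator_of_mem hx, ENNReal.ofReal_mul (Gpot_nonneg (fun _ => ENNReal.toReal_nonneg) hx),
      ENNReal.ofReal_toReal (hW.ne_top x)]
  · exact ae_mem_H.mono fun x hx => mul_nonneg (Gpot_nonneg (fun _ => ENNReal.toReal_nonneg) hx)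
      ENNReal.toReal_nonneg

lemma patchApprox (hW : Density W) (ε : ℝ) :
    Density ((patchApprox ε W).indicator 1) := by
  refine ⟨measurable_one.indicator (measurableSet_patchApprox ε hW.measurable), fun x => ?_,
    fun x hx => indicator_of_notMem (fun h => hx (patchApprox_subset_H hW.eq_zero h)) _⟩
  exact indicator_le_self' (fun _ _ => zero_le_one) x

lemma exists_energy_patchApprox (hW : Density W) {M : ℝ} (hM : 0 ≤ M) (hmass : ∫⁻ x, W x ≤ 1)
    (himp : ∫⁻ x, ENNReal.ofReal x.2 * W x = ENNReal.ofReal M) :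
    ∃ C : ℝ, 0 ≤ C ∧ ∀ ε > 0, ∃ f, memK M f ∧
      energy (fun x => (W x).toReal) - C * ε ≤ energy f := by
  set w : ℝ × ℝ → ℝ := fun x => (W x).toReal with hw
  have aW : Adm w := (hW.memKt hM hmass himp.le).adm
  obtain ⟨C, hC, hLip⟩ := aW.exists_Gpot_lipschitz
  refine ⟨C, hC, fun ε hε => ?_⟩
  set A := _root_.patchApprox ε W with hA
  have hAm : MeasurableSet A := measurableSet_patchApprox ε hW.measurable
  have hAH : A ⊆ H := patchApprox_subset_H hW.eq_zero
  set V : ℝ × ℝ → ENNReal := A.indicator 1 with hVdef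
  have hV : Density V := hW.patchApprox ε
  have hVint : ∀ Φ : ℝ × ℝ → ENNReal, ∫⁻ x, Φ x * V x = ∫⁻ x in A, Φ x := fun Φ => by
    rw [← lintegral_indicator hAm]
    congr with x
    by_cases hx : x ∈ A <;> simp [hVdef, hx]
  have hvol : volume A = ∫⁻ x, W x := by
    have := lintegral_patchApprox_snd hε hW.measurable hW.le_one (g := 1) measurable_one
    simpa using this
  have hVmass : ∫⁻ x, V x = volume A := by
    simpa using hVint 1
  have hVimp : ∫⁻ x, ENNReal.ofReal x.2 * V x = ENNReal.ofReal M := by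
    rw [hVint, ← himp]
    exact lintegral_patchApprox_snd hε hW.measurable hW.le_one (g := ENNReal.ofReal)
      ENNReal.measurable_ofReal
  have hVKt := hV.memKt hM (by rwa [hVmass, hvol]) hVimp.le
  have hf : (fun x => (V x).toReal) = A.indicator fun _ => (1 : ℝ) := by
    ext x
    by_cases hx : x ∈ A <;> simp [hVdef, hx]
  have aV := hVKt.adm
  refine ⟨fun x => (V x).toReal, ⟨hVKt.1, A, hAH, hAm, ae_of_all _ fun x => congr_fun hf x, ?_,
    by rwa [hvol]⟩, ?_⟩
  · rw [integral_eq_lintegral_of_nonneg_ae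
      ((ae_restrict_mem hAm).mono fun x hx => (show 0 < x.2 from hAH hx).le)
      measurable_snd.aestronglyMeasurable, ← hVint fun x => ENNReal.ofReal x.2, hVimp,
      ENNReal.toReal_ofReal hM]
  set f : ℝ × ℝ → ℝ := fun x => (V x).toReal
  have hI : interaction w w ≤ interaction f w + C * ε := by
    have hIf : 0 ≤ interaction f w := by
      rw [interaction_eq_integral_Gpot]
      exact integral_nonneg_of_ae (ae_mem_H.mono fun x hx =>
        mul_nonneg (Gpot_nonneg (fun _ => ENNReal.toReal_nonneg) hx) ENNReal.toReal_nonneg)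
    rw [← ENNReal.ofReal_le_ofReal_iff (by positivity), ENNReal.ofReal_add hIf (by positivity),
      hW.ofReal_interaction aW aW, hV.ofReal_interaction aV aW, hVint]
    refine (lintegral_mul_le_patchApprox hε hW.measurable hW.le_one
      ((measurable_Gpot hW.measurable.ennreal_toReal).ennreal_ofReal.indicator measurableSet_H)
      (c := ENNReal.ofReal (C * ε)) fun a b y hab => ?_).trans ?_
    · by_cases hy : 0 < y
      · rw [indicator_of_mem (show (a, y) ∈ H from hy), indicator_of_mem (show (b, y) ∈ H from hy),
          ← ENNReal.ofReal_add (Gpot_nonneg (fun _ => ENNReal.toReal_nonneg) hy) (by positivity)]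
        apply ENNReal.ofReal_le_ofReal
        have h₁ := (le_abs_self _).trans (hLip a b y hy)
        have h₂ : C * |a - b| ≤ C * ε := by gcongr
        linarith
      · rw [indicator_of_notMem (show (a, y) ∉ H from hy)]
        exact zero_le
    · gcongr
      exact mul_le_of_le_one_right' hmass
  have hsub := aV.sub aW
  have hdec := aW.energy_add hsub
  have hpos : 0 ≤ energy fun x => f x - w x := by
    rw [energy_eq_interaction]
    have := hsub.interaction_self_nonneg
    positivity
  have hcross : interaction w (fun x => f x - w x) = interaction f w - interaction w w := by
    have := hsub.interaction_add_left aW aW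
    simp only [sub_add_cancel] at this
    rw [aW.interaction_comm hsub]
    linarith
  simp only [add_sub_cancel] at hdec
  linarith

end Density

lemma G_lt_G_add {x y : ℝ × ℝ} (hx : x ∈ H) (hy : y ∈ H) (hxy : x ≠ y) {t : ℝ} (ht : 0 < t) :
    G x y < G (x + (0, t)) (y + (0, t)) := by
  have hx : 0 < x.2 := hx
  have hy : 0 < y.2 := hy
  have hd : 0 < (x.1 - y.1) ^ 2 + (x.2 - y.2) ^ 2 := by
    rw [← planeDist_sq]
    exact pow_pos (planeDist_pos hxy) 2
  have hpi := Real.pi_pos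
  simp only [G, Prod.fst_add, Prod.snd_add, add_zero, add_sub_add_right_eq_sub]
  gcongr <;> linarith

/-- The upward translate of a density by `t`. -/
def liftUp (t : ℝ) (W : ℝ × ℝ → ENNReal) (x : ℝ × ℝ) : ENNReal := W (x - (0, t))

namespace Density

variable {W : ℝ × ℝ → ENNReal}

lemma liftUp (hW : Density W) {t : ℝ} (ht : 0 ≤ t) : Density (liftUp t W) := by
  refine ⟨hW.measurable.comp (measurable_id.sub_const _), fun x => hW.le_one _, fun x hx => ?_⟩
  refine hW.eq_zero _ fun h => hx ?_
  have h : 0 < x.2 - t := h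
  exact (by linarith : 0 < x.2)

lemma lintegral_liftUp (W : ℝ × ℝ → ENNReal) (t : ℝ) : ∫⁻ x, _root_.liftUp t W x = ∫⁻ x, W x :=
  lintegral_sub_right_eq_self W _

lemma lintegral_snd_mul_liftUp (hW : Density W) {t : ℝ} (ht : 0 ≤ t) :
    ∫⁻ x, ENNReal.ofReal x.2 * _root_.liftUp t W x
      = (∫⁻ x, ENNReal.ofReal x.2 * W x) + ENNReal.ofReal t * ∫⁻ x, W x := by
  rw [← lintegral_add_right_eq_self _ ((0, t) : ℝ × ℝ), ← lintegral_const_mul _ hW.measurable,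
    ← lintegral_add_right _ (hW.measurable.const_mul _)]
  congr with x
  simp only [_root_.liftUp, add_sub_cancel_right, Prod.snd_add]
  by_cases hx : x ∈ H
  · rw [ENNReal.ofReal_add (show 0 < x.2 from hx).le ht, add_mul]
  · simp [hW.eq_zero x hx]

lemma ofReal_interaction_self (hW : Density W) (aW : Adm fun x => (W x).toReal) :
    ENNReal.ofReal (interaction (fun x => (W x).toReal) fun x => (W x).toReal)
      = ∫⁻ p : (ℝ × ℝ) × (ℝ × ℝ), ENNReal.ofReal (G p.1 p.2) * (W p.1 * W p.2) := by
  rw [aW.interaction_eq_integral_prod aW, ofReal_integral_eq_lintegral_ofReal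
    (aW.integrable_interaction aW), Measure.prod_restrict,
    ← lintegral_indicator (measurableSet_H.prod measurableSet_H)]
  · refine lintegral_congr fun p => ?_
    by_cases hp : p ∈ H ×ˢ H
    · rw [indicator_of_mem hp, mul_assoc, ENNReal.ofReal_mul (G_nonneg hp.1 hp.2),
        ENNReal.ofReal_mul ENNReal.toReal_nonneg, ENNReal.ofReal_toReal (hW.ne_top _),
        ENNReal.ofReal_toReal (hW.ne_top _)]
    · rw [indicator_of_notMem hp]
      rcases not_and_or.1 hp with h | h <;> simp [hW.eq_zero _ h]
  · filter_upwards [ae_prod_mem_H] with p hp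
    exact mul_nonneg (mul_nonneg (G_nonneg hp.1 hp.2) ENNReal.toReal_nonneg) ENNReal.toReal_nonneg

lemma energy_lt_energy_liftUp (hW : Density W) {t : ℝ} (ht : 0 < t)
    (aW : Adm fun x => (W x).toReal) (aV : Adm fun x => (_root_.liftUp t W x).toReal)
    (hmass : ∫⁻ x, W x ≠ 0) :
    energy (fun x => (W x).toReal) < energy fun x => (_root_.liftUp t W x).toReal := by
  rw [energy_eq_interaction, energy_eq_interaction]
  refine mul_lt_mul_of_pos_left ?_ one_half_pos
  refine lt_of_not_ge fun hle => ?_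
  have hle := ENNReal.ofReal_le_ofReal hle
  have : (volume : Measure ((ℝ × ℝ) × (ℝ × ℝ))).IsAddRightInvariant :=
    inferInstanceAs (volume.prod volume).IsAddRightInvariant
  have hW' := hW.ofReal_interaction_self aW
  rw [(hW.liftUp ht.le).ofReal_interaction_self aV, hW',
    ← lintegral_add_right_eq_self _ (((0, t), (0, t)) : (ℝ × ℝ) × (ℝ × ℝ))] at hle
  refine hle.not_gt ?_
  simp only [_root_.liftUp, Prod.fst_add, Prod.snd_add, add_sub_cancel_right]
  have hm : Measurable fun p : (ℝ × ℝ) × (ℝ × ℝ) => W p.1 * W p.2 :=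
    (hW.measurable.comp measurable_fst).mul (hW.measurable.comp measurable_snd)
  have hmG : Measurable fun p : (ℝ × ℝ) × (ℝ × ℝ) =>
      ENNReal.ofReal (G (p.1 + (0, t)) (p.2 + (0, t))) :=
    (measurable_G.comp (measurable_id.add_const
      (((0, t), (0, t)) : (ℝ × ℝ) × (ℝ × ℝ)))).ennreal_ofReal
  have hlt : ∀ᵐ p : (ℝ × ℝ) × (ℝ × ℝ), W p.1 * W p.2 ≠ 0 →
      ENNReal.ofReal (G p.1 p.2) * (W p.1 * W p.2)
        < ENNReal.ofReal (G (p.1 + (0, t)) (p.2 + (0, t))) * (W p.1 * W p.2) := by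
    filter_upwards [ae_prod_ne volume volume] with p hne hp
    have h₁ : p.1 ∈ H := by
      by_contra h
      simp [hW.eq_zero _ h] at hp
    have h₂ : p.2 ∈ H := by
      by_contra h
      simp [hW.eq_zero _ h] at hp
    have hlt := G_lt_G_add h₁ h₂ hne ht
    exact (ENNReal.mul_lt_mul_iff_left hp (ENNReal.mul_ne_top (hW.ne_top _) (hW.ne_top _))).2
      ((ENNReal.ofReal_lt_ofReal_iff ((G_nonneg h₁ h₂).trans_lt hlt)).2 hlt)
  refine lintegral_strict_mono_of_ae_le_of_ae_lt_on (s := {p | W p.1 * W p.2 ≠ 0})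
    (hmG.mul hm).aemeasurable (by rw [← hW']; exact ENNReal.ofReal_ne_top) ?_ ?_ hlt
  · filter_upwards [hlt] with p hp
    by_cases h : W p.1 * W p.2 = 0
    · simp [h]
    · exact (hp h).le
  · intro h0
    have : ∫⁻ p : (ℝ × ℝ) × (ℝ × ℝ), W p.1 * W p.2 = 0 :=
      (lintegral_eq_zero_iff hm).2 (ae_iff.2 h0)
    rw [Measure.volume_eq_prod, lintegral_prod_mul hW.measurable.aemeasurable
      hW.measurable.aemeasurable] at this
    exact hmass (mul_self_eq_zero.1 this)

end Density

lemma energy_nonneg {f : ℝ × ℝ → ℝ} (hf : Adm f) : 0 ≤ energy f := by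
  rw [energy_eq_interaction]
  have := hf.interaction_self_nonneg
  positivity

lemma impulse_nonneg (ω : ℝ × ℝ → ℝ) : 0 ≤ impulse ω :=
  integral_nonneg_of_ae
    (ae_mem_H.mono fun x hx => mul_nonneg (show 0 < x.2 from hx).le (abs_nonneg _))

lemma snd_mul_abs_ae_eq {ω : ℝ × ℝ → ℝ} {A : Set (ℝ × ℝ)}
    (hA : ∀ᵐ x ∂volume.restrict H, ω x = A.indicator (fun _ => (1 : ℝ)) x) :
    (fun x : ℝ × ℝ => x.2 * |ω x|) =ᵐ[volume.restrict H] A.indicator fun x => x.2 := by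
  filter_upwards [hA] with x hx
  by_cases hxA : x ∈ A <;> simp [hx, hxA]

lemma memK.memKt {M : ℝ} (hM : M ≠ 0) {ω : ℝ × ℝ → ℝ} (h : memK M ω) : memKt M ω := by
  obtain ⟨hωi, A, hAH, hAm, hA, hAM, hA1⟩ := h
  have habs : (fun x => |ω x|) =ᵐ[volume.restrict H] A.indicator fun _ => (1 : ℝ) := by
    filter_upwards [hA] with x hx
    by_cases hxA : x ∈ A <;> simp [hx, hxA]
  have hsnd := snd_mul_abs_ae_eq hA
  have hi : Integrable (fun x : ℝ × ℝ => x.2) (volume.restrict A) := by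
    by_contra hn
    rw [integral_undef hn] at hAM
    exact hM hAM.symm
  refine ⟨hωi, ?_, ?_, ?_, ?_⟩
  · filter_upwards [hA] with x hx
    by_cases hxA : x ∈ A <;> simp [hx, hxA]
  · rw [norm1, integral_congr_ae habs, setIntegral_H_indicator hAm hAH, setIntegral_const,
      smul_eq_mul, mul_one]
    exact ENNReal.toReal_le_of_le_ofReal zero_le_one (by simpa using hA1)
  · exact (((integrable_indicator_iff hAm).2 hi).mono_measure Measure.restrict_le_self).congr
      hsnd.symm
  · rw [impulse, integral_congr_ae hsnd, setIntegral_H_indicator hAm hAH, hAM]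

/-- A density of nonzero mass can be lifted upwards until its impulse equals `M`, which increases
its energy, strictly so if the impulse was less than `M`. -/
lemma Density.exists_lift {W : ℝ × ℝ → ENNReal} (hW : Density W) {m M : ℝ} (hm : 0 ≤ m)
    (hmM : m ≤ M) (hmass : ∫⁻ x, W x ≤ 1) (hmass0 : ∫⁻ x, W x ≠ 0)
    (himp : ∫⁻ x, ENNReal.ofReal x.2 * W x = ENNReal.ofReal m) :
    ∃ V, Density V ∧ ∫⁻ x, V x ≤ 1 ∧ ∫⁻ x, ENNReal.ofReal x.2 * V x = ENNReal.ofReal M ∧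
      energy (fun x => (W x).toReal) ≤ energy (fun x => (V x).toReal) ∧
      (m < M → energy (fun x => (W x).toReal) < energy fun x => (V x).toReal) := by
  rcases hmM.eq_or_lt with rfl | hlt
  · exact ⟨W, hW, hmass, himp, le_rfl, fun h => absurd h (lt_irrefl _)⟩
  have hfin : ∫⁻ x, W x ≠ ⊤ := (hmass.trans_lt ENNReal.one_lt_top).ne
  have hpos := ENNReal.toReal_pos hmass0 hfin
  set t := (M - m) / (∫⁻ x, W x).toReal with ht
  have ht0 : 0 < t := div_pos (sub_pos.2 hlt) hpos
  have hV := hW.liftUp ht0.le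
  have hVmass : ∫⁻ x, _root_.liftUp t W x ≤ 1 := by rwa [lintegral_liftUp]
  have hVimp : ∫⁻ x, ENNReal.ofReal x.2 * _root_.liftUp t W x = ENNReal.ofReal M := by
    rw [hW.lintegral_snd_mul_liftUp ht0.le, himp, ← ENNReal.ofReal_toReal hfin,
      ← ENNReal.ofReal_mul ht0.le, ← ENNReal.ofReal_add hm (by positivity), ht,
      div_mul_cancel₀ _ hpos.ne', add_sub_cancel]
  have hE := hW.energy_lt_energy_liftUp ht0 (hW.memKt hm hmass himp.le).adm
    (hV.memKt (hm.trans hmM) hVmass hVimp.le).adm hmass0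
  exact ⟨_, hV, hVmass, hVimp, hE.le, fun _ => hE⟩

lemma exists_memKt_energy_pos {M : ℝ} (hM : 0 < M) : ∃ f, memKt M f ∧ 0 < energy f := by
  set m := min (1 / 2) (M / 2) with hm
  have hm0 : 0 < m := by positivity
  set B : Set (ℝ × ℝ) := Ioo 0 1 ×ˢ Ioo 0 m with hB
  have hBm : MeasurableSet B := measurableSet_Ioo.prod measurableSet_Ioo
  set W : ℝ × ℝ → ENNReal := B.indicator 1 with hWdef
  have hW : Density W := by
    refine ⟨measurable_one.indicator hBm, fun x => ?_,
      fun x hx => indicator_of_notMem (fun h => hx h.2.1) _⟩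
    exact indicator_le_self' (fun _ _ => zero_le_one) x
  have hmass : ∫⁻ x, W x = ENNReal.ofReal m := by
    rw [hWdef, lintegral_indicator_one hBm, hB, Measure.volume_eq_prod, Measure.prod_prod,
      Real.volume_Ioo, Real.volume_Ioo]
    simp
  have hmass1 : ∫⁻ x, W x ≤ 1 := by
    rw [hmass, ENNReal.ofReal_le_one]
    exact (min_le_left _ _).trans (by norm_num)
  have himp : ∫⁻ x, ENNReal.ofReal x.2 * W x ≤ ENNReal.ofReal (M / 2) := by
    calc _ ≤ ∫⁻ x, 1 * W x := lintegral_mono fun x => ?_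
      _ ≤ ENNReal.ofReal (M / 2) := by
        simp only [one_mul]
        rw [hmass]
        exact ENNReal.ofReal_le_ofReal (min_le_right _ _)
    by_cases hx : x ∈ B
    · gcongr
      rw [ENNReal.ofReal_le_one]
      exact hx.2.2.le.trans ((min_le_left _ _).trans (by norm_num))
    · simp [hWdef, hx]
  have himp' := (ENNReal.ofReal_toReal (himp.trans_lt ENNReal.ofReal_lt_top).ne).symm
  have hle : (∫⁻ x, ENNReal.ofReal x.2 * W x).toReal ≤ M / 2 :=
    ENNReal.toReal_le_of_le_ofReal (by positivity) himp
  obtain ⟨V, hV, hV1, hVM, -, hE⟩ := hW.exists_lift (M := M) ENNReal.toReal_nonneg (by linarith)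
    hmass1 (by simpa [hmass] using hm0) himp'
  exact ⟨_, hV.memKt hM.le hV1 hVM.le, (energy_nonneg
    (hW.memKt (by positivity) hmass1 himp).adm).trans_lt (hE (by linarith))⟩

lemma energy_eq_zero_of_lintegral_eq_zero {W : ℝ × ℝ → ENNReal} (hW : Density W)
    (h : ∫⁻ x, W x = 0) : energy (fun x => (W x).toReal) = 0 := by
  have h0 : (fun x => (W x).toReal) =ᵐ[volume.restrict H] fun _ => 0 := by
    filter_upwards [ae_restrict_of_ae ((lintegral_eq_zero_iff hW.measurable).1 h)] with x hx
    simp [hx]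
  rw [energy_congr h0]
  simp [energy]

/-- The energy over the relaxed class is approximated by that of patches. -/
lemma memKt.exists_memK_energy_ge {M : ℝ} (hM : 0 < M) {ω : ℝ × ℝ → ℝ} (h : memKt M ω)
    (h0 : 0 < energy ω) {δ : ℝ} (hδ : 0 < δ) : ∃ f, memK M f ∧ energy ω - δ ≤ energy f := by
  obtain ⟨W, hW, hae, hmass, himp⟩ := h.exists_density
  rw [energy_congr hae] at h0 ⊢
  have hmass0 : ∫⁻ x, W x ≠ 0 := fun h => h0.ne' (energy_eq_zero_of_lintegral_eq_zero hW h)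
  obtain ⟨V, hV, hV1, hVM, hE, -⟩ := hW.exists_lift (impulse_nonneg ω) h.2.2.2.2 hmass hmass0 himp
  obtain ⟨C, hC, hf⟩ := hV.exists_energy_patchApprox hM.le hV1 hVM
  obtain ⟨f, hfK, hfE⟩ := hf (δ / (C + 1)) (by positivity)
  refine ⟨f, hfK, ?_⟩
  have : C * (δ / (C + 1)) ≤ δ := by
    rw [← mul_div_assoc, div_le_iff₀ (by positivity)]
    nlinarith
  linarith

lemma memKt.impulse_eq_of_isMax {M : ℝ} (hM : 0 < M) {ω : ℝ × ℝ → ℝ} (h : memKt M ω)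
    (hmax : ∀ ω', memKt M ω' → energy ω' ≤ energy ω) : impulse ω = M := by
  obtain ⟨W, hW, hae, hmass, himp⟩ := h.exists_density
  obtain ⟨f, hf, hf0⟩ := exists_memKt_energy_pos hM
  have h0 : 0 < energy ω := hf0.trans_le (hmax f hf)
  have hmass0 : ∫⁻ x, W x ≠ 0 := fun h => by
    rw [energy_congr hae, energy_eq_zero_of_lintegral_eq_zero hW h] at h0
    exact lt_irrefl _ h0
  obtain ⟨V, hV, hV1, hVM, -, hE⟩ := hW.exists_lift (impulse_nonneg ω) h.2.2.2.2 hmass hmass0 himp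
  by_contra hne
  have := hE (lt_of_le_of_ne h.2.2.2.2 hne)
  rw [← energy_congr hae] at this
  exact this.not_ge (hmax _ (hV.memKt hM.le hV1 hVM.le))

lemma memKt.add_perturbation {M : ℝ} {w g : ℝ × ℝ → ℝ} (hw : memKt M w) (hg : Adm g)
    (h01 : ∀ᵐ x ∂volume.restrict H, 0 ≤ w x + g x ∧ w x + g x ≤ 1)
    (hg0 : ∫ x in H, g x = 0) (hg1 : ∫ x in H, x.2 * g x = 0) : memKt M fun x => w x + g x := by
  have aw := hw.adm
  have hsum := aw.add hg
  have himp : (fun x : ℝ × ℝ => x.2 * |w x + g x|) =ᵐ[volume.restrict H]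
      fun x => x.2 * w x + x.2 * g x := by
    filter_upwards [h01] with x hx
    rw [abs_of_nonneg hx.1, mul_add]
  refine ⟨hsum.integrable, h01, ?_, (aw.impulse.add hg.impulse).congr himp.symm, ?_⟩
  · refine le_trans (le_of_eq ?_) hw.2.2.1
    unfold norm1
    rw [integral_congr_ae (h01.mono fun x hx => abs_of_nonneg hx.1),
      integral_add aw.integrable hg.integrable, hg0, add_zero]
    exact integral_congr_ae (hw.2.1.mono fun x hx => (abs_of_nonneg hx.1).symm)
  · refine le_trans (le_of_eq ?_) hw.2.2.2.2
    unfold impulse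
    rw [integral_congr_ae himp, integral_add aw.impulse hg.impulse, hg1, add_zero]
    exact integral_congr_ae (hw.2.1.mono fun x hx => by simp only [abs_of_nonneg hx.1])

lemma memKt.volume_eq_zero_of_isMax {M : ℝ} {w : ℝ × ℝ → ℝ} (hw : memKt M w)
    (hmax : ∀ ω', memKt M ω' → energy ω' ≤ energy w) {S : Set (ℝ × ℝ)} (hS : MeasurableSet S)
    {N δ : ℝ} (hδ : 0 < δ) (hsub : ∀ x ∈ S, |x.1| ≤ N ∧ δ ≤ x.2 ∧ x.2 ≤ N)
    (hwS : ∀ x ∈ S, δ ≤ w x ∧ w x ≤ 1 - δ) : volume S = 0 := by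
  by_contra hpos
  obtain ⟨g, C, ag, hC, hgS, hg0, hg1, hI⟩ := exists_positive_perturbation hS hδ hsub hpos
  have hC0 : 0 ≤ C := (abs_nonneg _).trans (hC 0)
  have aw := hw.adm
  set η := δ / (C + 1) with hη
  have hη0 : 0 < η := by positivity
  have hηC : η * C ≤ δ := by
    rw [hη, div_mul_eq_mul_div, div_le_iff₀ (by positivity)]
    nlinarith
  have key : ∀ c : ℝ, |c| = η → c * interaction g w + c ^ 2 / 2 * interaction g g ≤ 0 := by
    intro c hc
    have acg := ag.const_mul c
    have hK : memKt M fun x => w x + c * g x := by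
      refine hw.add_perturbation acg ?_ ?_ ?_
      · filter_upwards [hw.2.1] with x hx
        by_cases hxS : x ∈ S
        · have hb : |c * g x| ≤ δ := by
            rw [abs_mul, hc]
            exact (mul_le_mul_of_nonneg_left (hC x) hη0.le).trans hηC
          have h₁ := abs_le.1 hb
          have h₂ := hwS x hxS
          constructor <;> linarith [h₁.1, h₁.2, h₂.1, h₂.2]
        · simpa [hgS x hxS] using hx
      · rw [integral_const_mul, hg0, mul_zero]
      · simp_rw [mul_left_comm _ c]
        rw [integral_const_mul, hg1, mul_zero]
    have hE := hmax _ hK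
    have h₁ : interaction (fun x => c * g x) (fun x => c * g x) = c ^ 2 * interaction g g := by
      rw [interaction_const_mul_left, ag.interaction_comm acg, interaction_const_mul_left]
      ring
    rw [aw.energy_add acg, aw.interaction_comm acg, interaction_const_mul_left,
      energy_eq_interaction fun x => c * g x, h₁] at hE
    linarith
  have h₁ := key η (abs_of_pos hη0)
  have h₂ := key (-η) (by rw [abs_neg, abs_of_pos hη0])
  have : 0 < η ^ 2 * interaction g g := by positivity
  nlinarith

lemma memKt.exists_indicator_of_isMax {M : ℝ} {ω : ℝ × ℝ → ℝ} (h : memKt M ω)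
    (hmax : ∀ ω', memKt M ω' → energy ω' ≤ energy ω) :
    ∃ A : Set (ℝ × ℝ), A ⊆ H ∧ MeasurableSet A ∧
      ∀ᵐ x ∂volume.restrict H, ω x = A.indicator (fun _ => (1 : ℝ)) x := by
  obtain ⟨W, hW, hae, hmass, himp⟩ := h.exists_density
  set w : ℝ × ℝ → ℝ := fun x => (W x).toReal with hwdef
  have hwm : Measurable w := hW.measurable.ennreal_toReal
  have hM : 0 ≤ M := (impulse_nonneg ω).trans h.2.2.2.2
  have hw : memKt M w :=
    hW.memKt hM hmass (himp.trans_le (ENNReal.ofReal_le_ofReal h.2.2.2.2))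
  rw [energy_congr hae] at hmax
  have hnull : volume {x | x ∈ H ∧ 0 < w x ∧ w x < 1} = 0 := by
    set S : ℕ → Set (ℝ × ℝ) := fun n => {x | (|x.1| ≤ n + 1 ∧ 1 / (n + 1 : ℝ) ≤ x.2 ∧ x.2 ≤ n + 1) ∧
      1 / (n + 1 : ℝ) ≤ w x ∧ w x ≤ 1 - 1 / (n + 1 : ℝ)} with hS
    have hSm : ∀ n, MeasurableSet (S n) := fun n => by
      have habs : Measurable fun x : ℝ × ℝ => |x.1| := by fun_prop
      exact ((measurableSet_le habs measurable_const).inter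
        ((measurableSet_le measurable_const measurable_snd).inter
          (measurableSet_le measurable_snd measurable_const))).inter
        ((measurableSet_le measurable_const hwm).inter (measurableSet_le hwm measurable_const))
    have hS0 : ∀ n, volume (S n) = 0 := fun n =>
      hw.volume_eq_zero_of_isMax hmax (hSm n) (N := n + 1) (δ := 1 / (n + 1)) (by positivity)
        (fun x hx => hx.1) fun x hx => hx.2
    refine measure_mono_null (fun x hx => ?_) (measure_iUnion_null hS0)
    obtain ⟨hxH, hx0, hx1⟩ := hx
    have hxH : 0 < x.2 := hxH
    have hinv := tendsto_one_div_add_atTop_nhds_zero_nat (𝕜 := ℝ)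
    have hnat : Tendsto (fun n : ℕ => (n + 1 : ℝ)) atTop atTop :=
      tendsto_atTop_add_const_right _ _ tendsto_natCast_atTop_atTop
    obtain ⟨n, h₁, h₂, h₃, h₄, h₅⟩ := ((hnat.eventually_ge_atTop |x.1|).and
      ((hinv.eventually_le_const hxH).and ((hnat.eventually_ge_atTop x.2).and
      ((hinv.eventually_le_const hx0).and (hinv.eventually_le_const (sub_pos.2 hx1)))))).exists
    exact mem_iUnion.2 ⟨n, ⟨h₁, h₂, h₃⟩, h₄, by linarith⟩
  refine ⟨H ∩ {x | w x = 1}, inter_subset_left,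
    measurableSet_H.inter (measurableSet_eq_fun hwm measurable_const), ?_⟩
  filter_upwards [hae, ae_mem_H, ae_restrict_of_ae (measure_eq_zero_iff_ae_notMem.1 hnull)]
    with x hx hxH hxn
  rw [hx]
  by_cases h1 : w x = 1
  · rw [indicator_of_mem (show x ∈ H ∩ {x | w x = 1} from ⟨hxH, h1⟩)]
    exact h1
  · rw [indicator_of_notMem fun hmem => h1 hmem.2]
    by_contra h0
    exact hxn ⟨hxH, lt_of_le_of_ne ENNReal.toReal_nonneg (Ne.symm h0),
      lt_of_le_of_ne (hW.toReal_le_one x) h1⟩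

lemma memKt.memK_of_ae_eq_indicator {M : ℝ} {ω : ℝ × ℝ → ℝ} (h : memKt M ω)
    (himp : impulse ω = M) {A : Set (ℝ × ℝ)} (hAH : A ⊆ H) (hAm : MeasurableSet A)
    (hA : ∀ᵐ x ∂volume.restrict H, ω x = A.indicator (fun _ => (1 : ℝ)) x) : memK M ω := by
  refine ⟨h.1, A, hAH, hAm, hA, ?_, ?_⟩
  · rw [← setIntegral_H_indicator hAm hAH, ← integral_congr_ae (snd_mul_abs_ae_eq hA)]
    exact himp
  · have hlin : ∫⁻ x in H, ‖ω x‖ₑ = volume A := by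
      rw [← inter_eq_self_of_subset_left hAH, ← Measure.restrict_apply hAm,
        ← lintegral_indicator_one hAm]
      refine lintegral_congr_ae (hA.mono fun x hx => ?_)
      by_cases hxA : x ∈ A <;> simp [hx, hxA]
    rw [← hlin, ← ofReal_integral_norm_eq_lintegral_enorm h.1]
    exact ENNReal.ofReal_le_one.2 h.2.2.1

/-- the maximizers of `E` over the relaxed class `K̃_M` are exactly the
maximizers over the patch class `K_M`; in particular every relaxed maximizer has full
impulse and is a.e. an indicator function. -/
theorem relaxed_maximizers_eq_patch_maximizers (M : ℝ) (hM : 0 < M)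
    (ω : ℝ × ℝ → ℝ) (hω : memKt M ω) :
    ((∀ ω' : ℝ × ℝ → ℝ, memKt M ω' → energy ω' ≤ energy ω) ↔
      (memK M ω ∧ ∀ ω'' : ℝ × ℝ → ℝ, memK M ω'' → energy ω'' ≤ energy ω)) ∧
    ((∀ ω' : ℝ × ℝ → ℝ, memKt M ω' → energy ω' ≤ energy ω) →
      impulse ω = M ∧
      ∃ A : Set (ℝ × ℝ), A ⊆ H ∧ MeasurableSet A ∧
        (∀ᵐ x ∂volume.restrict H, ω x = A.indicator (fun _ => (1 : ℝ)) x)) := by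
  have hpatch : (∀ ω' : ℝ × ℝ → ℝ, memKt M ω' → energy ω' ≤ energy ω) →
      impulse ω = M ∧ ∃ A : Set (ℝ × ℝ), A ⊆ H ∧ MeasurableSet A ∧
        (∀ᵐ x ∂volume.restrict H, ω x = A.indicator (fun _ => (1 : ℝ)) x) := fun hmax =>
    ⟨hω.impulse_eq_of_isMax hM hmax, hω.exists_indicator_of_isMax hmax⟩
  refine ⟨⟨fun hmax => ?_, fun hmax ω' hω' => ?_⟩, hpatch⟩
  · obtain ⟨himp, A, hAH, hAm, hA⟩ := hpatch hmax
    exact ⟨hω.memK_of_ae_eq_indicator himp hAH hAm hA, fun ω'' h => hmax ω'' (h.memKt hM.ne')⟩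
  · rcases le_or_gt (energy ω') 0 with h0 | h0
    · exact h0.trans (energy_nonneg hω.adm)
    · refine le_of_forall_pos_le_add fun δ hδ => ?_
      obtain ⟨f, hf, hfE⟩ := hω'.exists_memK_energy_ge hM h0 hδ
      linarith [hmax.2 f hf]
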